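/- Let n ≥ 3 and let Ω = B(0,R) \ closure B(z,ρ) ⊂ ℝⁿ be an eccentric spherical annulus, where z = a·eₙ with a ≠ 0, 0 < ρ < R, and closure B(z,ρ) ⊂ B(0,R). Let H ∈ ℝ, and let u ∈ C²(Ω) ∩ C(closure Ω) solve the constant mean curvature equation div(∇u/√(1+|∇u|²)) = H in Ω with u = 0 on ∂Ω, u not identically zero and u rotationally symmetric about the xₙ-axis. Then the critical set K = {x ∈ Ω : ∇u(x) = 0} is invariant under every rotation about the xₙ-axis, and its trace on a meridian half-plane is finite: the set K ∩ {x ∈ ℝⁿ : x₁ ≥ 0, x₂ = ⋯ = x_{n−1} = 0} is finite. Consequently K is the union of finitely many isolated points lying on the xₙ-axis and finitely many circles that are orbits of points under the rotations about the xₙ-axis. -/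

import Mathlib

open Set Metric

noncomputable section

/-- The coefficients `a_{ij}(p) = (1+|p|²)^{-1/2}(δ_{ij} − pᵢpⱼ/(1+|p|²))`
of the mean curvature operator. -/
def mcCoeff {n : ℕ} (p : EuclideanSpace ℝ (Fin n)) (i j : Fin n) : ℝ :=
  (Real.sqrt (1 + ‖p‖ ^ 2))⁻¹ * ((if i = j then 1 else 0) - p i * p j / (1 + ‖p‖ ^ 2))

/-- Second partial derivative `∂²u/∂xᵢ∂xⱼ`. -/
def hessEntry {n : ℕ} (u : EuclideanSpace ℝ (Fin n) → ℝ) (x : EuclideanSpace ℝ (Fin n))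
    (i j : Fin n) : ℝ :=
  iteratedFDeriv ℝ 2 u x ![EuclideanSpace.single i 1, EuclideanSpace.single j 1]

/-- The Hessian matrix `D²u(x)`. -/
def hessMatrix {n : ℕ} (u : EuclideanSpace ℝ (Fin n) → ℝ) (x : EuclideanSpace ℝ (Fin n)) :
    Matrix (Fin n) (Fin n) ℝ :=
  Matrix.of fun i j => hessEntry u x i j

/-- The mean curvature operator `L u = div(∇u/√(1+|∇u|²)) = Σ a_{ij}(∇u) ∂²u/∂xᵢ∂xⱼ`. -/
def meanCurv {n : ℕ} (u : EuclideanSpace ℝ (Fin n) → ℝ) (x : EuclideanSpace ℝ (Fin n)) : ℝ :=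
  ∑ i, ∑ j, mcCoeff (gradient u x) i j * hessEntry u x i j

/-- A solution of the Dirichlet problem `L u = f(u)` in `Ω`, `u = 0` on `∂Ω`:
`u ∈ C²(Ω) ∩ C(closure Ω)`. -/
def IsMCSolution {n : ℕ} (Ω : Set (EuclideanSpace ℝ (Fin n))) (f : ℝ → ℝ)
    (u : EuclideanSpace ℝ (Fin n) → ℝ) : Prop :=
  ContDiffOn ℝ 2 u Ω ∧ ContinuousOn u (closure Ω) ∧
    (∀ x ∈ Ω, meanCurv u x = f (u x)) ∧ (∀ x ∈ frontier Ω, u x = 0)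

/-- A rotation about the `k`-th coordinate axis: a linear isometry fixing `e_k` and
preserving the hyperplane spanned by the other coordinate vectors. -/
def IsAxisRotation {n : ℕ} (k : Fin n)
    (g : EuclideanSpace ℝ (Fin n) ≃ₗᵢ[ℝ] EuclideanSpace ℝ (Fin n)) : Prop :=
  g (EuclideanSpace.single k 1) = EuclideanSpace.single k 1 ∧
    ∀ x : EuclideanSpace ℝ (Fin n), x k = 0 → g x k = 0

/-- A continuous angle whose cosine stays nonnegative cannot wind. -/
theorem sub_eq_arcsin_sub_of_cos_nonneg {θ : ℝ → ℝ} (hθ : Continuous θ)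
    (hcos : ∀ t, 0 ≤ Real.cos (θ t)) (s t : ℝ) :
    θ t - θ s = Real.arcsin (Real.sin (θ t)) - Real.arcsin (Real.sin (θ s)) := by
  have hint : ∀ r, ∃ m : ℤ, θ r - Real.arcsin (Real.sin (θ r)) = m * (2 * Real.pi) := by
    intro r
    have hc : Real.cos (θ r) = Real.cos (Real.arcsin (Real.sin (θ r))) := by
      rw [Real.cos_arcsin, ← Real.cos_sq', Real.sqrt_sq (hcos r)]
    have hs : Real.sin (θ r) = Real.sin (Real.arcsin (Real.sin (θ r))) :=
      (Real.sin_arcsin (Real.neg_one_le_sin _) (Real.sin_le_one _)).symm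
    have := Real.Angle.cos_sin_inj hc hs
    obtain ⟨m, hm⟩ := Real.Angle.angle_eq_iff_two_pi_dvd_sub.1 this
    exact ⟨m, by rw [hm]; ring⟩
  choose m hm using hint
  have hmc : Continuous m := by
    have hcont : Continuous fun r => θ r - Real.arcsin (Real.sin (θ r)) :=
      hθ.sub (Real.continuous_arcsin.comp (Real.continuous_sin.comp hθ))
    have h2 : Continuous fun r => (m r : ℝ) := by
      have : (fun r => (m r : ℝ)) =
          fun r => (θ r - Real.arcsin (Real.sin (θ r))) / (2 * Real.pi) := by
        funext r
        rw [hm r, mul_div_cancel_right₀ _ (by positivity)]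
      rw [this]
      exact hcont.div_const _
    exact Int.isClosedEmbedding_coe_real.isEmbedding.continuous_iff.2 h2
  have hconst : m t = m s :=
    isPreconnected_univ.constant hmc.continuousOn (mem_univ t) (mem_univ s)
  have h1 := hm t
  have h2 := hm s
  rw [hconst] at h1
  linarith

theorem sub_eq_arcsin_sub_of_cos_nonpos {θ : ℝ → ℝ} (hθ : Continuous θ)
    (hcos : ∀ t, Real.cos (θ t) ≤ 0) (s t : ℝ) :
    θ t - θ s = Real.arcsin (-Real.sin (θ t)) - Real.arcsin (-Real.sin (θ s)) := by
  have := sub_eq_arcsin_sub_of_cos_nonneg (θ := fun r => θ r + Real.pi)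
    (hθ.add continuous_const) (fun r => by rw [Real.cos_add_pi]; linarith [hcos r]) s t
  simp only [Real.sin_add_pi] at this
  linarith

/-- In the closed right half-plane, two connected curves whose endpoints alternate on the
imaginary axis meet. -/
theorem not_disjoint_of_alternating {S T : Set ℂ} (hS : IsPathConnected S)
    (hT : IsPathConnected T) (hSr : ∀ w ∈ S, 0 ≤ w.re) (hTr : ∀ w ∈ T, 0 ≤ w.re)
    {A B C D : ℝ} (hAB : A < B) (hBC : B < C) (hCD : C < D)
    (hA : (A * Complex.I : ℂ) ∈ S) (hB : (B * Complex.I : ℂ) ∈ T)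
    (hC : (C * Complex.I : ℂ) ∈ S) (hD : (D * Complex.I : ℂ) ∈ T) : ¬ Disjoint S T := by
  intro hdisj
  obtain ⟨f, hf⟩ := hS.joinedIn _ hA _ hC
  obtain ⟨g, hg⟩ := hT.joinedIn _ hB _ hD
  have hfe : ∀ s, f.extend s ∈ S := fun s => hf (projIcc 0 1 zero_le_one s)
  have hge : ∀ s, g.extend s ∈ T := fun s => hg (projIcc 0 1 zero_le_one s)
  let F : C(ℝ × ℝ, ℂ) := ⟨fun q => f.extend q.1 - g.extend q.2, by fun_prop⟩
  have hF0 : ∀ q, F q ≠ 0 := fun q h =>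
    hdisj.ne_of_mem (hfe q.1) (hge q.2) (sub_eq_zero.1 h)
  obtain ⟨L, ⟨-, hL⟩, -⟩ := Complex.isCoveringMapOn_exp.existsUnique_continuousMap_lifts F
    (a₀ := (0, 0)) (e₀ := Complex.log (F (0, 0))) (Complex.exp_log (hF0 _)) (fun q => hF0 q)
  have hLF : ∀ q, Complex.exp (L q) = F q := fun q => congrFun hL q
  let θ : ℝ × ℝ → ℝ := fun q => (L q).im
  have hθ : Continuous θ := Complex.continuous_im.comp L.continuous
  have hre : ∀ q, (F q).re = Real.exp (L q).re * Real.cos (θ q) := fun q => by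
    rw [← hLF, Complex.exp_re]
  have him : ∀ q, (F q).im = Real.exp (L q).re * Real.sin (θ q) := fun q => by
    rw [← hLF, Complex.exp_im]
  have hcp : ∀ q, 0 ≤ (F q).re → 0 ≤ Real.cos (θ q) := fun q h => by
    rw [hre] at h
    exact nonneg_of_mul_nonneg_right h (Real.exp_pos _)
  have hcn : ∀ q, (F q).re ≤ 0 → Real.cos (θ q) ≤ 0 := fun q h => by
    rw [hre] at h
    exact nonpos_of_mul_nonpos_right h (Real.exp_pos _)
  have hsin : ∀ q, (F q).re = 0 → 0 < (F q).im → Real.sin (θ q) = 1 := fun q h h' => by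
    rw [hre] at h
    rw [him] at h'
    have hc : Real.cos (θ q) = 0 := (mul_eq_zero.1 h).resolve_left (Real.exp_pos _).ne'
    have hs : 0 < Real.sin (θ q) := pos_of_mul_pos_right h' (Real.exp_pos _).le
    nlinarith [Real.sin_sq_add_cos_sq (θ q)]
  have hsin' : ∀ q, (F q).re = 0 → (F q).im < 0 → Real.sin (θ q) = -1 := fun q h h' => by
    rw [hre] at h
    rw [him] at h'
    have hc : Real.cos (θ q) = 0 := (mul_eq_zero.1 h).resolve_left (Real.exp_pos _).ne'
    have hs : Real.sin (θ q) < 0 := by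
      by_contra hcon
      push Not at hcon
      exact absurd h' (not_lt.2 (mul_nonneg (Real.exp_pos _).le hcon))
    nlinarith [Real.sin_sq_add_cos_sq (θ q)]
  have hs00 := hsin' (0, 0) (by simp [F]) (by simp [F, hAB])
  have hs10 := hsin (1, 0) (by simp [F]) (by simp [F, hBC])
  have hs11 := hsin' (1, 1) (by simp [F]) (by simp [F, hCD])
  have hs01 := hsin' (0, 1) (by simp [F]) (by simp [F]; linarith)
  have e1 := sub_eq_arcsin_sub_of_cos_nonneg (θ := fun s => θ (s, 0)) (by fun_prop)
    (fun s => hcp _ (by simp [F, hSr _ (hfe s)])) 0 1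
  have e2 := sub_eq_arcsin_sub_of_cos_nonpos (θ := fun s => θ (1, s)) (by fun_prop)
    (fun s => hcn _ (by simp [F, hTr _ (hge s)])) 0 1
  have e3 := sub_eq_arcsin_sub_of_cos_nonneg (θ := fun s => θ (s, 1)) (by fun_prop)
    (fun s => hcp _ (by simp [F, hSr _ (hfe s)])) 0 1
  have e4 := sub_eq_arcsin_sub_of_cos_nonpos (θ := fun s => θ (0, s)) (by fun_prop)
    (fun s => hcn _ (by simp [F, hTr _ (hge s)])) 0 1
  simp only [hs00, hs10, hs11, hs01, neg_neg, Real.arcsin_neg, Real.arcsin_one] at e1 e2 e3 e4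
  linarith [Real.pi_pos]


/-- The part of the circle of radius `r` about `t₀ i` in the closed right half-plane whose
imaginary parts lie in `[a, b]`. -/
def halfArc (t₀ r a b : ℝ) : Set ℂ :=
  (fun s : ℝ => ((Real.sqrt (r ^ 2 - (s - t₀) ^ 2) : ℝ) : ℂ) + s * Complex.I) '' Icc a b

theorem isCompact_halfArc (t₀ r a b : ℝ) : IsCompact (halfArc t₀ r a b) :=
  isCompact_Icc.image (by fun_prop)

theorem isPathConnected_halfArc {t₀ r a b : ℝ} (hab : a ≤ b) :
    IsPathConnected (halfArc t₀ r a b) :=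
  ((convex_Icc a b).isPathConnected (nonempty_Icc.2 hab)).image (by fun_prop)

theorem dist_mul_I_sq (w : ℂ) (t : ℝ) :
    dist w (t * Complex.I) ^ 2 = w.re ^ 2 + (w.im - t) ^ 2 := by
  rw [dist_eq_norm, Complex.sq_norm, Complex.normSq_apply]
  simp
  ring

theorem abs_im_sub_le_dist (w : ℂ) (t : ℝ) : |w.im - t| ≤ dist w (t * Complex.I) := by
  have := Complex.abs_im_le_norm (w - t * Complex.I)
  simpa [dist_eq_norm] using this

theorem halfArc_spec {t₀ r a b : ℝ} (hr : 0 ≤ r) (ha : t₀ - r ≤ a) (hb : b ≤ t₀ + r) {w : ℂ}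
    (hw : w ∈ halfArc t₀ r a b) :
    0 ≤ w.re ∧ dist w (t₀ * Complex.I) = r ∧ a ≤ w.im ∧ w.im ≤ b := by
  obtain ⟨s, ⟨hs1, hs2⟩, rfl⟩ := hw
  have hnn : 0 ≤ r ^ 2 - (s - t₀) ^ 2 := by nlinarith
  refine ⟨by simp, ?_, by simpa using hs1, by simpa using hs2⟩
  rw [← sq_eq_sq₀ dist_nonneg hr, dist_mul_I_sq]
  simp [Real.sq_sqrt hnn]

theorem mem_halfArc {t₀ a b : ℝ} {w : ℂ} (hw : 0 ≤ w.re) (ha : a ≤ w.im) (hb : w.im ≤ b) :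
    w ∈ halfArc t₀ (dist w (t₀ * Complex.I)) a b := by
  refine ⟨w.im, ⟨ha, hb⟩, ?_⟩
  have : Real.sqrt (dist w (t₀ * Complex.I) ^ 2 - (w.im - t₀) ^ 2) = w.re := by
    rw [dist_mul_I_sq, add_sub_cancel_right, Real.sqrt_sq hw]
  apply Complex.ext <;> simp [this]

theorem mul_I_mem_halfArc {t₀ r a b s : ℝ} (hs : s ∈ Icc a b) (h : (s - t₀) ^ 2 = r ^ 2) :
    (s * Complex.I : ℂ) ∈ halfArc t₀ r a b :=
  ⟨s, hs, by simp [h]⟩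

theorem exists_ball_disjoint {C : Set ℂ} (hC : IsClosed C) {w : ℂ} (hw : w ∉ C) :
    ∃ ε > 0, Disjoint (ball w (2 * ε)) C := by
  obtain ⟨ε, hε, h⟩ := Metric.isOpen_iff.1 hC.isOpen_compl w hw
  refine ⟨ε / 2, by positivity, ?_⟩
  rw [mul_div_cancel₀ _ two_ne_zero]
  exact disjoint_left.2 fun x hx => h hx

/-- Two disjoint curves in the right half-plane, one from the centre `t₀ i` to `o` and the other
from the axis point below the centre to `y`, cannot coexist if `o` can be joined to the axis
downwards and `y` upwards along circles about the centre without creating intersections. -/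
theorem planar_separation {t₀ τ : ℝ} (hτ : 0 < τ) {E N : Set ℂ} (hE : IsPathConnected E)
    (hN : IsPathConnected N) (hEr : ∀ w ∈ E, 0 ≤ w.re) (hNr : ∀ w ∈ N, 0 ≤ w.re)
    (hEN : Disjoint E N) (hp : (t₀ * Complex.I : ℂ) ∈ E)
    (hq : ((t₀ - τ : ℝ) * Complex.I : ℂ) ∈ N) {o y : ℂ} (ho : o ∈ closure E)
    (hy : y ∈ closure N) (hor : 0 ≤ o.re) (hyr : 0 ≤ y.re) (hoN : o ∉ closure N)
    (hyE : y ∉ closure E) (hτo : τ < dist o (t₀ * Complex.I))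
    (hEy : ∀ w ∈ E, dist w (t₀ * Complex.I) < dist y (t₀ * Complex.I))
    (harc : ∀ w : ℂ, 0 ≤ w.re → dist w (t₀ * Complex.I) = dist o (t₀ * Complex.I) →
      w.im ≤ o.im → w ∉ N ∧ w ≠ y ∧
        ¬ (dist w (t₀ * Complex.I) = dist y (t₀ * Complex.I) ∧ y.im ≤ w.im)) : False := by
  set r := dist o (t₀ * Complex.I) with hr
  set r' := dist y (t₀ * Complex.I) with hr'
  have hr0 : 0 ≤ r := dist_nonneg
  have hr'0 : 0 < r' := lt_of_le_of_lt dist_nonneg (hEy _ hp)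
  have hoim := abs_le.1 (abs_im_sub_le_dist o t₀)
  have hyim := abs_le.1 (abs_im_sub_le_dist y t₀)
  rw [← hr] at hoim
  rw [← hr'] at hyim
  have hAspec : ∀ w ∈ halfArc t₀ r (t₀ - r) o.im, _ := fun w hw =>
    halfArc_spec hr0 le_rfl (by linarith) hw
  have hBspec : ∀ w ∈ halfArc t₀ r' y.im (t₀ + r'), _ := fun w hw =>
    halfArc_spec hr'0.le (by linarith) le_rfl hw
  have hoA : o ∈ halfArc t₀ r (t₀ - r) o.im := mem_halfArc hor (by linarith) le_rfl
  have hyB : y ∈ halfArc t₀ r' y.im (t₀ + r') := mem_halfArc hyr le_rfl (by linarith)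
  have hoB : o ∉ halfArc t₀ r' y.im (t₀ + r') := fun h =>
    (harc o hor rfl le_rfl).2.2 ⟨(hBspec o h).2.1, (hBspec o h).2.2.1⟩
  have hyA : y ∉ halfArc t₀ r (t₀ - r) o.im := fun h =>
    (harc y hyr (hAspec y h).2.1 (hAspec y h).2.2.2).2.1 rfl
  obtain ⟨ε, hε, hεd⟩ := exists_ball_disjoint
    (isClosed_closure.union (isCompact_halfArc t₀ r' y.im (t₀ + r')).isClosed)
    (w := o) (C := closure N ∪ _) (by simp [hoN, hoB])
  obtain ⟨ε', hε', hεd'⟩ := exists_ball_disjoint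
    (isClosed_closure.union (isCompact_halfArc t₀ r (t₀ - r) o.im).isClosed)
    (w := y) (C := closure E ∪ _) (by simp [hyE, hyA])
  have hconv : ∀ (c : ℂ) (δ : ℝ), 0 < δ → 0 ≤ c.re → IsPathConnected (ball c δ ∩ {w | 0 ≤ w.re}) :=
    fun c δ hδ hc => ((convex_ball c δ).inter (convex_halfSpace_re_ge 0)).isPathConnected
      ⟨c, mem_ball_self hδ, hc⟩
  have hmem : ∀ (c : ℂ) (δ : ℝ), 0 < δ → 0 ≤ c.re → c ∈ ball c δ ∩ {w | 0 ≤ w.re} :=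
    fun c δ hδ hc => ⟨mem_ball_self hδ, hc⟩
  have hS : IsPathConnected (E ∪ (ball o ε ∩ {w | 0 ≤ w.re}) ∪ halfArc t₀ r (t₀ - r) o.im) := by
    refine (hE.union (hconv o ε hε hor) ?_).union
      (isPathConnected_halfArc (by linarith)) ⟨o, Or.inr (hmem o ε hε hor), hoA⟩
    obtain ⟨w, hw, hwo⟩ := Metric.mem_closure_iff.1 ho ε hε
    exact ⟨w, hw, by rwa [mem_ball, dist_comm], hEr w hw⟩
  have hT : IsPathConnected
      (N ∪ (ball y ε' ∩ {w | 0 ≤ w.re}) ∪ halfArc t₀ r' y.im (t₀ + r')) := by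
    refine (hN.union (hconv y ε' hε' hyr) ?_).union
      (isPathConnected_halfArc (by linarith)) ⟨y, Or.inr (hmem y ε' hε' hyr), hyB⟩
    obtain ⟨w, hw, hwo⟩ := Metric.mem_closure_iff.1 hy ε' hε'
    exact ⟨w, hw, by rwa [mem_ball, dist_comm], hNr w hw⟩
  refine not_disjoint_of_alternating hS hT ?_ ?_ (A := t₀ - r) (B := t₀ - τ) (C := t₀)
    (D := t₀ + r') (by linarith) (by linarith) (by linarith)
    (Or.inr (mul_I_mem_halfArc ⟨le_rfl, by linarith⟩ (by ring))) (Or.inl (Or.inl hq))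
    (Or.inl (Or.inl hp)) (Or.inr (mul_I_mem_halfArc ⟨by linarith, le_rfl⟩ (by ring))) ?_
  · rintro w ((hw | hw) | hw)
    exacts [hEr w hw, hw.2, (hAspec w hw).1]
  · rintro w ((hw | hw) | hw)
    exacts [hNr w hw, hw.2, (hBspec w hw).1]
  · refine disjoint_left.2 ?_
    have hod : ∀ w ∈ ball o ε, w ∉ closure N ∪ halfArc t₀ r' y.im (t₀ + r') := fun w hw =>
      disjoint_left.1 hεd (ball_subset_ball (by linarith) hw)
    have hyd : ∀ w ∈ ball y ε', w ∉ closure E ∪ halfArc t₀ r (t₀ - r) o.im := fun w hw =>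
      disjoint_left.1 hεd' (ball_subset_ball (by linarith) hw)
    rintro w ((hw | hw) | hw) ((hw' | hw') | hw')
    · exact disjoint_left.1 hEN hw hw'
    · exact hyd w hw'.1 (Or.inl (subset_closure hw))
    · exact (hEy w hw).ne (hBspec w hw').2.1
    · exact hod w hw.1 (Or.inl (subset_closure hw'))
    · have h1 : 2 * ε ≤ dist y o := by
        by_contra! h
        exact disjoint_left.1 hεd (mem_ball.2 h) (Or.inr hyB)
      have h2 : 2 * ε' ≤ dist o y := by
        by_contra! h
        exact disjoint_left.1 hεd' (mem_ball.2 h) (Or.inr hoA)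
      have h3 := dist_triangle_left o y w
      rw [dist_comm y o] at h1
      linarith [mem_ball.1 hw.1, mem_ball.1 hw'.1]
    · exact hod w hw.1 (Or.inr hw')
    · obtain ⟨h1, h2, -, h4⟩ := hAspec w hw
      exact (harc w h1 h2 h4).1 hw'
    · exact hyd w hw'.1 (Or.inr hw)
    · obtain ⟨h1, h2, -, h4⟩ := hAspec w hw
      obtain ⟨-, h6, h7, -⟩ := hBspec w hw'
      exact (harc w h1 h2 h4).2.2 ⟨h6, h7⟩

open Filter Topology Asymptotics in
theorem ContDiffAt.isLittleO_taylor_two {E : Type*} [NormedAddCommGroup E] [NormedSpace ℝ E]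
    {w : E → ℝ} {x : E} (hw : ContDiffAt ℝ 2 w x) (h0 : fderiv ℝ w x = 0) :
    (fun v => w (x + v) - w x - 2⁻¹ * fderiv ℝ (fderiv ℝ w) x v v) =o[𝓝 0] fun v => ‖v‖ ^ 2 := by
  set B := fderiv ℝ (fderiv ℝ w) x with hB
  have hsymm : ∀ v v', B v v' = B v' v := fun v v' =>
    (hw.isSymmSndFDerivAt (by simp [minSmoothness_of_isRCLikeNormedField])).eq v v'
  have hd : HasFDerivAt (fderiv ℝ w) B x :=
    ((hw.fderiv_right (m := 1) (by norm_num)).differentiableAt (by norm_num)).hasFDerivAt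
  have hdiff : ∀ᶠ v in 𝓝 (0 : E), DifferentiableAt ℝ w (x + v) := by
    have h1 : ∀ᶠ y in 𝓝 x, DifferentiableAt ℝ w y :=
      (hw.eventually (by simp)).mono fun y hy => hy.differentiableAt (by norm_num)
    have h2 : Tendsto (fun v : E => x + v) (𝓝 0) (𝓝 x) := by
      have h3 : Continuous fun v : E => x + v := by fun_prop
      simpa using h3.tendsto 0
    exact h2.eventually h1
  rw [hasFDerivAt_iff_isLittleO_nhds_zero] at hd
  rw [isLittleO_iff]
  intro c hc
  have hd' := isLittleO_iff.1 hd hc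
  obtain ⟨r, hr, hball⟩ := Metric.eventually_nhds_iff_ball.1 (hd'.and hdiff)
  filter_upwards [Metric.ball_mem_nhds (0 : E) hr] with v hv
  have hv' : ‖v‖ < r := by simpa using hv
  have key := (convex_closedBall (0 : E) ‖v‖).norm_image_sub_le_of_norm_hasFDerivWithin_le
    (f := fun v => w (x + v) - 2⁻¹ * B v v) (f' := fun v => fderiv ℝ w (x + v) - B v)
    (C := c * ‖v‖) (x := 0) (y := v) ?_ ?_ (by simp) (by simp)
  · simpa [pow_two, mul_assoc, sub_right_comm] using key
  · intro y hy
    have hyr : y ∈ Metric.ball (0 : E) r := by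
      simp only [Metric.mem_closedBall, dist_zero_right] at hy
      simpa using hy.trans_lt hv'
    have h1 : HasFDerivAt (fun v => w (x + v)) (fderiv ℝ w (x + y)) y :=
      by
      simpa [Function.comp_def] using HasFDerivAt.comp y (hball y hyr).2.hasFDerivAt ((hasFDerivAt_id y).const_add x)
    have h2 : HasFDerivAt (fun v => 2⁻¹ * B v v) (B y) y := by
      have h := (B.hasFDerivAt_of_bilinear (hasFDerivAt_id (𝕜 := ℝ) y)
        (hasFDerivAt_id y)).const_mul 2⁻¹
      refine h.congr_fderiv ?_
      ext v
      simp [ContinuousLinearMap.precompR, ContinuousLinearMap.precompL, hsymm v y]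
      ring
    exact (h1.sub h2).hasFDerivWithinAt
  · intro y hy
    have hy' : ‖y‖ ≤ ‖v‖ := by simpa using hy
    have hyr : y ∈ Metric.ball (0 : E) r := by simpa using hy'.trans_lt hv'
    have := (hball y hyr).1
    rw [h0, sub_zero] at this
    exact this.trans (by gcongr)

open Filter Topology Asymptotics in
theorem tendsto_sub_div_sq_of_fderiv_eq_zero {E : Type*} [NormedAddCommGroup E] [NormedSpace ℝ E]
    {w : E → ℝ} {x V : E} {γ : ℝ → E} (hw : ContDiffAt ℝ 2 w x) (h0 : fderiv ℝ w x = 0)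
    (hγ0 : γ 0 = x) (hγ : HasDerivAt γ V 0) :
    Tendsto (fun s => (w (γ s) - w x) / s ^ 2) (𝓝[≠] 0)
      (𝓝 (2⁻¹ * fderiv ℝ (fderiv ℝ w) x V V)) := by
  set B := fderiv ℝ (fderiv ℝ w) x with hB
  have ht := hw.isLittleO_taylor_two h0
  have hslope : Tendsto (fun s => s⁻¹ • (γ s - x)) (𝓝[≠] 0) (𝓝 V) := by
    have := hasDerivAt_iff_tendsto_slope.1 hγ
    refine this.congr' (Eventually.of_forall fun s => ?_)
    simp [slope_def_module, hγ0]
  have hγc : Tendsto (fun s => γ s - x) (𝓝[≠] 0) (𝓝 0) := by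
    have := hγ.continuousAt.tendsto.mono_left (nhdsWithin_le_nhds (s := {0}ᶜ))
    rw [hγ0] at this
    simpa using this.sub_const x
  have hO : (fun s => ‖γ s - x‖ ^ 2) =O[𝓝[≠] 0] fun s : ℝ => s ^ 2 := by
    have h1 : (fun s => γ s - x) =O[𝓝[≠] 0] fun s : ℝ => s := by
      have := hγ.isBigO_sub.mono (nhdsWithin_le_nhds (s := {0}ᶜ))
      simpa [hγ0] using this
    exact h1.norm_left.pow 2
  have h2 := ((ht.comp_tendsto hγc).trans_isBigO hO).tendsto_div_nhds_zero
  have h3 : Tendsto (fun s : ℝ => 2⁻¹ * B (s⁻¹ • (γ s - x)) (s⁻¹ • (γ s - x))) (𝓝[≠] 0)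
      (𝓝 (2⁻¹ * B V V)) := by
    have hc : Continuous fun v : E => 2⁻¹ * B v v :=
      continuous_const.mul (B.continuous.clm_apply continuous_id)
    exact (hc.tendsto V).comp hslope
  have h4 := h2.add h3
  rw [zero_add] at h4
  refine h4.congr' ?_
  filter_upwards [self_mem_nhdsWithin] with s hs
  have hs : s ≠ 0 := hs
  simp
  field_simp
  ring

open Filter Topology in
theorem sndFDeriv_nonpos_of_curve {E : Type*} [NormedAddCommGroup E] [NormedSpace ℝ E]
    {w : E → ℝ} {x V : E} {γ : ℝ → E} (hw : ContDiffAt ℝ 2 w x) (h0 : fderiv ℝ w x = 0)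
    (hγ0 : γ 0 = x) (hγ : HasDerivAt γ V 0) (hle : ∃ᶠ s in 𝓝[≠] 0, w (γ s) ≤ w x) :
    fderiv ℝ (fderiv ℝ w) x V V ≤ 0 := by
  have h := tendsto_sub_div_sq_of_fderiv_eq_zero hw h0 hγ0 hγ
  have : 2⁻¹ * fderiv ℝ (fderiv ℝ w) x V V ≤ 0 := by
    refine le_of_tendsto_of_frequently h (hle.mono fun s hs => ?_)
    exact div_nonpos_of_nonpos_of_nonneg (by linarith) (sq_nonneg s)
  linarith

open Filter Topology in
theorem sndFDeriv_nonneg_of_curve {E : Type*} [NormedAddCommGroup E] [NormedSpace ℝ E]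
    {w : E → ℝ} {x V : E} {γ : ℝ → E} (hw : ContDiffAt ℝ 2 w x) (h0 : fderiv ℝ w x = 0)
    (hγ0 : γ 0 = x) (hγ : HasDerivAt γ V 0) (hle : ∃ᶠ s in 𝓝[≠] 0, w x ≤ w (γ s)) :
    0 ≤ fderiv ℝ (fderiv ℝ w) x V V := by
  have h := tendsto_sub_div_sq_of_fderiv_eq_zero hw h0 hγ0 hγ
  have : 0 ≤ 2⁻¹ * fderiv ℝ (fderiv ℝ w) x V V := by
    refine ge_of_tendsto_of_frequently h (hle.mono fun s hs => ?_)
    exact div_nonneg (by linarith) (sq_nonneg s)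
  linarith

section MeanCurvature

variable {n : ℕ}

theorem bilin_apply_self_eq_sum
    (B : EuclideanSpace ℝ (Fin n) →L[ℝ] EuclideanSpace ℝ (Fin n) →L[ℝ] ℝ)
    (p : EuclideanSpace ℝ (Fin n)) : B p p = ∑ i, ∑ j, p i * p j *
      B (EuclideanSpace.single i 1) (EuclideanSpace.single j 1) := by
  have hp : p = ∑ i, p i • EuclideanSpace.single i (1 : ℝ) := by
    ext j
    simp [Finset.sum_apply, Pi.single_apply]
  conv_lhs => rw [hp]
  simp only [map_sum, map_smul, sum_apply, smul_apply, smul_eq_mul, Finset.mul_sum]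
  rw [Finset.sum_comm]
  exact Finset.sum_congr rfl fun i _ => Finset.sum_congr rfl fun j _ => by ring

theorem meanCurv_eq (u : EuclideanSpace ℝ (Fin n) → ℝ) (x : EuclideanSpace ℝ (Fin n)) :
    meanCurv u x = (√(1 + ‖gradient u x‖ ^ 2))⁻¹ *
      ((∑ i, fderiv ℝ (fderiv ℝ u) x (EuclideanSpace.single i 1) (EuclideanSpace.single i 1)) -
        fderiv ℝ (fderiv ℝ u) x (gradient u x) (gradient u x) / (1 + ‖gradient u x‖ ^ 2)) := by
  set p := gradient u x
  set B := fderiv ℝ (fderiv ℝ u) x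
  have hB := bilin_apply_self_eq_sum B p
  have hm : ∀ i j, mcCoeff p i j * hessEntry u x i j = (√(1 + ‖p‖ ^ 2))⁻¹ *
      ((if i = j then B (EuclideanSpace.single i 1) (EuclideanSpace.single j 1) else 0) -
        p i * p j * B (EuclideanSpace.single i 1) (EuclideanSpace.single j 1) /
          (1 + ‖p‖ ^ 2)) := by
    intro i j
    have : hessEntry u x i j = B (EuclideanSpace.single i 1) (EuclideanSpace.single j 1) := by
      simp [hessEntry, iteratedFDeriv_two_apply, B]
    rw [this, mcCoeff]
    split_ifs <;> ring
  rw [meanCurv, Finset.sum_congr rfl fun i _ => Finset.sum_congr rfl fun j _ => hm i j]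
  simp only [← Finset.mul_sum, Finset.sum_sub_distrib, ← Finset.sum_div]
  rw [← hB]
  simp

theorem gradient_eq_of_fderiv_eq {u v : EuclideanSpace ℝ (Fin n) → ℝ}
    {x y : EuclideanSpace ℝ (Fin n)} (h : fderiv ℝ u x = fderiv ℝ v y) :
    gradient u x = gradient v y := by
  simp [gradient, h]

theorem fderiv_eq_zero_of_gradient_eq_zero {u : EuclideanSpace ℝ (Fin n) → ℝ}
    {x : EuclideanSpace ℝ (Fin n)} (h : gradient u x = 0) : fderiv ℝ u x = 0 := by
  simpa [gradient] using h

theorem meanCurv_of_fderiv_eq_zero {u : EuclideanSpace ℝ (Fin n) → ℝ}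
    {x : EuclideanSpace ℝ (Fin n)} (h : fderiv ℝ u x = 0) : meanCurv u x =
      ∑ i, fderiv ℝ (fderiv ℝ u) x (EuclideanSpace.single i 1) (EuclideanSpace.single i 1) := by
  have : gradient u x = 0 := by simp [gradient, h]
  simp [meanCurv_eq, this]

theorem norm_sq_mul_trace_sub_nonneg
    {N : EuclideanSpace ℝ (Fin n) →L[ℝ] EuclideanSpace ℝ (Fin n) →L[ℝ] ℝ}
    (hsymm : ∀ v w, N v w = N w v) (hN : ∀ v, 0 ≤ N v v) (p : EuclideanSpace ℝ (Fin n)) :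
    N p p ≤ ‖p‖ ^ 2 * ∑ i, N (EuclideanSpace.single i 1) (EuclideanSpace.single i 1) := by
  have hB := bilin_apply_self_eq_sum N p
  have key : 0 ≤ ∑ i, ∑ j, N (p i • EuclideanSpace.single j (1 : ℝ) - p j • EuclideanSpace.single i 1)
      (p i • EuclideanSpace.single j 1 - p j • EuclideanSpace.single i 1) :=
    Finset.sum_nonneg fun i _ => Finset.sum_nonneg fun j _ => hN _
  have e : ∀ i j, N (p i • EuclideanSpace.single j (1 : ℝ) - p j • EuclideanSpace.single i 1)
      (p i • EuclideanSpace.single j 1 - p j • EuclideanSpace.single i 1) =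
      p i ^ 2 * N (EuclideanSpace.single j 1) (EuclideanSpace.single j 1) +
      p j ^ 2 * N (EuclideanSpace.single i 1) (EuclideanSpace.single i 1) -
      2 * (p i * p j * N (EuclideanSpace.single i 1) (EuclideanSpace.single j 1)) := by
    intro i j
    simp only [map_sub, map_smul, sub_apply, smul_apply,
      smul_eq_mul]
    rw [hsymm (EuclideanSpace.single j 1) (EuclideanSpace.single i 1)]
    ring
  simp only [e, Finset.sum_sub_distrib, Finset.sum_add_distrib, ← Finset.mul_sum,
    ← Finset.sum_mul] at key
  rw [← hB, ← EuclideanSpace.real_norm_sq_eq] at key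
  linarith

open Filter Topology in
theorem sndFDeriv_sub {u v : EuclideanSpace ℝ (Fin n) → ℝ} {x : EuclideanSpace ℝ (Fin n)}
    (hu : ContDiffAt ℝ 2 u x) (hv : ContDiffAt ℝ 2 v x) :
    fderiv ℝ (fderiv ℝ (u - v)) x = fderiv ℝ (fderiv ℝ u) x - fderiv ℝ (fderiv ℝ v) x := by
  have h1 : fderiv ℝ (u - v) =ᶠ[𝓝 x] fderiv ℝ u - fderiv ℝ v := by
    filter_upwards [hu.eventually (by simp), hv.eventually (by simp)] with y hy hy'
    exact fderiv_sub (hy.differentiableAt (by norm_num)) (hy'.differentiableAt (by norm_num))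
  rw [h1.fderiv_eq]
  exact fderiv_sub ((hu.fderiv_right (m := 1) (by norm_num)).differentiableAt (by norm_num))
    ((hv.fderiv_right (m := 1) (by norm_num)).differentiableAt (by norm_num))

open Filter Topology in
theorem meanCurv_le_of_isLocalMax_sub {u v : EuclideanSpace ℝ (Fin n) → ℝ}
    {x : EuclideanSpace ℝ (Fin n)} (hu : ContDiffAt ℝ 2 u x) (hv : ContDiffAt ℝ 2 v x)
    (hmax : IsLocalMax (u - v) x) : meanCurv u x ≤ meanCurv v x := by
  have h0 : fderiv ℝ (u - v) x = 0 := hmax.fderiv_eq_zero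
  have hg : gradient u x = gradient v x := by
    refine gradient_eq_of_fderiv_eq (sub_eq_zero.1 ?_)
    rw [← h0, fderiv_sub (hu.differentiableAt (by norm_num)) (hv.differentiableAt (by norm_num))]
  have hneg : ∀ V, fderiv ℝ (fderiv ℝ (u - v)) x V V ≤ 0 := by
    intro V
    have hγ : HasDerivAt (fun s : ℝ => x + s • V) V 0 := by
      simpa using ((hasDerivAt_id (0 : ℝ)).smul_const V).const_add x
    refine sndFDeriv_nonpos_of_curve (hu.sub hv) h0 (by simp) hγ (Eventually.frequently ?_)
    have hc : Tendsto (fun s : ℝ => x + s • V) (𝓝[≠] 0) (𝓝 x) := by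
      simpa using hγ.continuousAt.tendsto.mono_left (nhdsWithin_le_nhds (s := {0}ᶜ))
    exact hc.eventually hmax
  set N := fderiv ℝ (fderiv ℝ v) x - fderiv ℝ (fderiv ℝ u) x with hN
  have hNn : ∀ V, 0 ≤ N V V := by
    intro V
    have := hneg V
    rw [sndFDeriv_sub hu hv] at this
    simp only [sub_apply, hN] at this ⊢
    linarith
  have hNs : ∀ V W, N V W = N W V := by
    intro V W
    simp only [sub_apply, hN]
    rw [(hu.isSymmSndFDerivAt (by simp [minSmoothness_of_isRCLikeNormedField])).eq V W,
      (hv.isSymmSndFDerivAt (by simp [minSmoothness_of_isRCLikeNormedField])).eq V W]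
  set p := gradient v x
  have htr := norm_sq_mul_trace_sub_nonneg hNs hNn p
  have htr0 : 0 ≤ ∑ i, N (EuclideanSpace.single i 1) (EuclideanSpace.single i 1) :=
    Finset.sum_nonneg fun i _ => hNn _
  rw [meanCurv_eq, meanCurv_eq, hg]
  have hpos : 0 < 1 + ‖p‖ ^ 2 := by positivity
  refine mul_le_mul_of_nonneg_left ?_ (by positivity)
  have hdiv : N p p / (1 + ‖p‖ ^ 2) ≤
      ∑ i, N (EuclideanSpace.single i 1) (EuclideanSpace.single i 1) := by
    rw [div_le_iff₀ hpos]
    linarith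
  simp only [hN, sub_apply, Finset.sum_sub_distrib, sub_div] at hdiv
  linarith

theorem inner_gradient_eq_fderiv (u : EuclideanSpace ℝ (Fin n) → ℝ)
    (x v : EuclideanSpace ℝ (Fin n)) : inner ℝ (gradient u x) v = fderiv ℝ u x v := by
  simp [gradient]

theorem sum_bilin_comp_isometry
    (B : EuclideanSpace ℝ (Fin n) →L[ℝ] EuclideanSpace ℝ (Fin n) →L[ℝ] ℝ)
    (T : EuclideanSpace ℝ (Fin n) ≃ₗᵢ[ℝ] EuclideanSpace ℝ (Fin n)) :
    ∑ i, B (T (EuclideanSpace.single i 1)) (T (EuclideanSpace.single i 1)) =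
      ∑ i, B (EuclideanSpace.single i 1) (EuclideanSpace.single i 1) := by
  have horth : ∀ l m, ∑ i, (T (EuclideanSpace.single i 1)) l * (T (EuclideanSpace.single i 1)) m =
      if m = l then 1 else 0 := by
    intro l m
    have h := ((EuclideanSpace.basisFun (Fin n) ℝ).map T).sum_inner_mul_inner
      (EuclideanSpace.single l (1 : ℝ)) (EuclideanSpace.single m (1 : ℝ))
    simpa [EuclideanSpace.inner_single_left, EuclideanSpace.inner_single_right,
      Pi.single_apply] using h
  simp only [bilin_apply_self_eq_sum B (T _)]
  rw [Finset.sum_comm]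
  have : ∀ l, ∑ i, ∑ m, (T (EuclideanSpace.single i 1)) l * (T (EuclideanSpace.single i 1)) m *
      B (EuclideanSpace.single l 1) (EuclideanSpace.single m 1) =
      B (EuclideanSpace.single l 1) (EuclideanSpace.single l 1) := by
    intro l
    rw [Finset.sum_comm]
    simp [← Finset.sum_mul, horth]
  exact Finset.sum_congr rfl fun l _ => this l

open Filter Topology in
theorem meanCurv_comp_similarity {u : EuclideanSpace ℝ (Fin n) → ℝ} {μ : ℝ} (hμ : 0 < μ)
    (T : EuclideanSpace ℝ (Fin n) ≃ₗᵢ[ℝ] EuclideanSpace ℝ (Fin n))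
    {b x : EuclideanSpace ℝ (Fin n)} (hu : ContDiffAt ℝ 2 u (μ • T x + b)) :
    meanCurv (fun y => μ⁻¹ * u (μ • T y + b)) x = μ * meanCurv u (μ • T x + b) := by
  set A : EuclideanSpace ℝ (Fin n) →L[ℝ] EuclideanSpace ℝ (Fin n) :=
    T.toContinuousLinearEquiv.toContinuousLinearMap with hA
  set v := fun y => μ⁻¹ * u (μ • T y + b) with hv
  set B := fderiv ℝ (fderiv ℝ u) (μ • T x + b) with hB
  have hφ : ∀ y, HasFDerivAt (fun y => μ • T y + b) (μ • A) y := fun y =>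
    (A.hasFDerivAt.const_smul μ).add_const b
  have hφt : Tendsto (fun y => μ • T y + b) (𝓝 x) (𝓝 (μ • T x + b)) :=
    (hφ x).continuousAt.tendsto
  have h1 : ∀ᶠ y in 𝓝 x, fderiv ℝ v y = (fderiv ℝ u (μ • T y + b)).comp A := by
    filter_upwards [hφt.eventually (hu.eventually (by simp))] with y hy
    have h := (((hy.differentiableAt (by norm_num)).hasFDerivAt).comp y (hφ y)).const_mul μ⁻¹
    refine HasFDerivAt.fderiv (h.congr_fderiv ?_)
    ext w
    simp [hμ.ne']
  have hd : HasFDerivAt (fderiv ℝ u) B (μ • T x + b) :=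
    ((hu.fderiv_right (m := 1) (by norm_num)).differentiableAt (by norm_num)).hasFDerivAt
  have h2 : ∀ w w', fderiv ℝ (fderiv ℝ v) x w w' = μ * B (T w) (T w') := by
    have h := (hd.comp x (hφ x)).clm_comp (hasFDerivAt_const A x)
    have e : fderiv ℝ v =ᶠ[𝓝 x]
      fun y => ((fderiv ℝ u ∘ fun y => μ • T y + b) y).comp A := h1
    intro w w'
    rw [e.fderiv_eq, h.fderiv]
    simp [hA]
  have hg : T (gradient v x) = gradient u (μ • T x + b) := by
    refine ext_inner_right ℝ fun w => ?_
    obtain ⟨w, rfl⟩ := T.surjective w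
    rw [LinearIsometryEquiv.inner_map_map, inner_gradient_eq_fderiv, inner_gradient_eq_fderiv,
      h1.self_of_nhds]
    simp [hA]
  have hn : ‖gradient v x‖ = ‖gradient u (μ • T x + b)‖ := by
    rw [← hg, LinearIsometryEquiv.norm_map]
  rw [meanCurv_eq, meanCurv_eq, hn]
  simp only [h2, hg, ← Finset.mul_sum]
  rw [sum_bilin_comp_isometry B T]
  ring

theorem meanCurv_neg (u : EuclideanSpace ℝ (Fin n) → ℝ) (x : EuclideanSpace ℝ (Fin n)) :
    meanCurv (-u) x = -meanCurv u x := by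
  have h1 : fderiv ℝ (-u) = -fderiv ℝ u := by
    ext1 y
    exact fderiv_neg
  have h2 : gradient (-u) x = -gradient u x := by
    simp only [gradient, h1, Pi.neg_apply, map_neg]
  rw [meanCurv_eq, meanCurv_eq, h2, h1, fderiv_neg]
  simp
  ring

end MeanCurvature

open Filter Topology in
theorem le_add_of_meanCurv_lt {n : ℕ} {G : Set (EuclideanSpace ℝ (Fin n))} (hGo : IsOpen G)
    (hGb : Bornology.IsBounded G) {u v : EuclideanSpace ℝ (Fin n) → ℝ}
    (hu : ContDiffOn ℝ 2 u G) (hv : ContDiffOn ℝ 2 v G)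
    (huc : ContinuousOn u (closure G)) (hvc : ContinuousOn v (closure G))
    (hlt : ∀ x ∈ G, meanCurv v x < meanCurv u x) {M : ℝ}
    (hM : ∀ x ∈ frontier G, u x ≤ v x + M) : ∀ x ∈ G, u x ≤ v x + M := by
  intro x hx
  obtain ⟨y, hy, hmax⟩ := hGb.isCompact_closure.exists_isMaxOn ⟨x, subset_closure hx⟩
    (huc.sub hvc)
  have hxy : u x - v x ≤ u y - v y := hmax (subset_closure hx)
  by_cases hyG : y ∈ G
  · exfalso
    refine (hlt y hyG).not_ge (meanCurv_le_of_isLocalMax_sub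
      (hu.contDiffAt (hGo.mem_nhds hyG)) (hv.contDiffAt (hGo.mem_nhds hyG)) ?_)
    filter_upwards [hGo.mem_nhds hyG] with w hw
    exact hmax (subset_closure hw)
  · have := hM y ⟨hy, by rwa [hGo.interior_eq]⟩
    linarith

open Filter Topology in
theorem le_add_of_meanCurv_eq {n : ℕ} {G : Set (EuclideanSpace ℝ (Fin n))} (hGo : IsOpen G)
    (hGb : Bornology.IsBounded G) {u v : EuclideanSpace ℝ (Fin n) → ℝ}
    (hu : ContDiffOn ℝ 2 u G) (hv : ContDiffOn ℝ 2 v G)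
    (huc : ContinuousOn u (closure G)) (hvc : ContinuousOn v (closure G))
    {H : ℝ} (hH : 0 < H) (hHu : ∀ x ∈ G, meanCurv u x = H) (hHv : ∀ x ∈ G, meanCurv v x = H)
    {M : ℝ} (hM : ∀ x ∈ frontier G, u x ≤ v x + M) : ∀ x ∈ G, u x ≤ v x + M := by
  intro x₀ hx₀
  refine le_of_forall_pos_le_add fun ε hε => ?_
  have hcpt := hGb.isCompact_closure
  obtain ⟨δ₁, hδ₁, h₁⟩ := Metric.uniformContinuousOn_iff.1
    (hcpt.uniformContinuousOn_of_continuous huc) (ε / 4) (by positivity)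
  obtain ⟨δ₂, hδ₂, h₂⟩ := Metric.uniformContinuousOn_iff.1
    (hcpt.uniformContinuousOn_of_continuous hvc) (ε / 4) (by positivity)
  obtain ⟨C, hC⟩ := hcpt.exists_bound_of_continuousOn huc
  obtain ⟨r, hr⟩ := hcpt.isBounded.exists_norm_le
  have hlim : ∀ b c : ℝ, 0 < b → ∀ᶠ μ in 𝓝[>] (1 : ℝ), (μ - 1) * c < b := by
    intro b c hb
    have hc : Continuous fun μ : ℝ => (μ - 1) * c := by fun_prop
    have := (hc.tendsto 1).mono_left (nhdsWithin_le_nhds (s := Ioi 1))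
    exact this.eventually (gt_mem_nhds (by simpa using hb))
  have hx₀G : ∀ᶠ μ in 𝓝[>] (1 : ℝ), μ • x₀ ∈ G := by
    have hc : Continuous fun μ : ℝ => μ • x₀ := by fun_prop
    have := (hc.tendsto 1).mono_left (nhdsWithin_le_nhds (s := Ioi 1))
    exact this.eventually (hGo.mem_nhds (by simpa using hx₀))
  obtain ⟨μ, hμ₁, hμ₂, hμC, hμG, hμ⟩ := ((hlim δ₁ r hδ₁).and ((hlim δ₂ r hδ₂).and
    ((hlim (ε / 4) C (by positivity)).and (hx₀G.and self_mem_nhdsWithin)))).exists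
  have hμ1 : 1 < μ := hμ
  have hμ0 : 0 < μ := by linarith
  have hdist : ∀ x ∈ closure G, dist (μ • x) x ≤ (μ - 1) * r := by
    intro x hx
    have : μ • x - x = (μ - 1) • x := by module
    rw [dist_eq_norm, this, norm_smul, Real.norm_of_nonneg (by linarith)]
    exact mul_le_mul_of_nonneg_left (hr x hx) (by linarith)
  have hu1 : ∀ x ∈ closure G, μ • x ∈ closure G → |u (μ • x) - u x| < ε / 4 :=
    fun x hx hx' => h₁ _ hx' _ hx ((hdist x hx).trans_lt hμ₁)
  have hv1 : ∀ x ∈ closure G, μ • x ∈ closure G → |v (μ • x) - v x| < ε / 4 :=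
    fun x hx hx' => h₂ _ hx' _ hx ((hdist x hx).trans_lt hμ₂)
  have hu2 : ∀ x ∈ closure G, |μ⁻¹ * u x - u x| < ε / 4 := by
    intro x hx
    have e : μ⁻¹ * u x - u x = (μ⁻¹ - 1) * u x := by ring
    have h1 : μ⁻¹ ≤ 1 := inv_le_one_of_one_le₀ hμ1.le
    have h2 : 1 - μ⁻¹ ≤ μ - 1 := by
      have : μ * μ⁻¹ = 1 := mul_inv_cancel₀ hμ0.ne'
      nlinarith [inv_pos.2 hμ0]
    rw [e, abs_mul, abs_of_nonpos (by linarith)]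
    calc -(μ⁻¹ - 1) * |u x| ≤ (μ - 1) * C :=
          mul_le_mul (by linarith) (hC x hx) (abs_nonneg _) (by linarith)
      _ < ε / 4 := hμC
  set G' := G ∩ (fun x => μ • x) ⁻¹' G with hG'
  have hcs : Continuous fun x : EuclideanSpace ℝ (Fin n) => μ • x := by fun_prop
  have hG'o : IsOpen G' := hGo.inter (hGo.preimage hcs)
  have hcl : ∀ x ∈ closure G', x ∈ closure G ∧ μ • x ∈ closure G := fun x hx =>
    ⟨closure_mono inter_subset_left hx,
      hcs.closure_preimage_subset G (closure_mono inter_subset_right hx)⟩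
  have main := le_add_of_meanCurv_lt hG'o (hGb.subset inter_subset_left)
    (u := fun x => μ⁻¹ * u (μ • x)) (v := v) (M := M + ε / 2) ?_ (hv.mono inter_subset_left) ?_
    (hvc.mono (closure_mono inter_subset_left)) ?_ ?_ x₀ ⟨hx₀, hμG⟩
  · have a1 := abs_lt.1 (hu2 (μ • x₀) (subset_closure hμG))
    have a2 := abs_lt.1 (hu1 x₀ (subset_closure hx₀) (subset_closure hμG))
    linarith [a1.1, a2.1]
  · exact contDiffOn_const.mul (hu.comp (by fun_prop) fun x hx => hx.2)
  · exact continuousOn_const.mul (huc.comp hcs.continuousOn fun x hx => (hcl x hx).2)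
  · intro x hx
    have h := meanCurv_comp_similarity hμ0 (LinearIsometryEquiv.refl ℝ _) (b := 0) (x := x)
      (u := u) (by simpa using hu.contDiffAt (hGo.mem_nhds hx.2))
    simp only [LinearIsometryEquiv.coe_refl, id, add_zero] at h
    rw [h, hHu _ hx.2, hHv _ hx.1]
    nlinarith
  · intro x hx
    obtain ⟨hx1, hx2⟩ := hcl x (frontier_subset_closure hx)
    have a1 := abs_lt.1 (hu2 (μ • x) hx2)
    have a2 := abs_lt.1 (hu1 x hx1 hx2)
    have a3 := abs_lt.1 (hv1 x hx1 hx2)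
    have hnot : x ∉ G' := by
      have := hx.2
      rwa [hG'o.interior_eq] at this
    by_cases hxG : x ∈ G
    · have hμx : μ • x ∉ G := fun h => hnot ⟨hxG, h⟩
      have := hM (μ • x) ⟨hx2, by rwa [hGo.interior_eq]⟩
      linarith [a1.2, a3.2]
    · have := hM x ⟨hx1, by rwa [hGo.interior_eq]⟩
      linarith [a1.2, a2.2]

/-- The lower hemisphere of radius `h` through the origin centred above `p`, as a graph. -/
def bowl {n : ℕ} (p : EuclideanSpace ℝ (Fin n)) (h : ℝ) (x : EuclideanSpace ℝ (Fin n)) : ℝ :=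
  h - √(h ^ 2 - ‖x - p‖ ^ 2)

section Bowl

variable {n : ℕ} {p x : EuclideanSpace ℝ (Fin n)} {h : ℝ}

theorem continuous_bowl : Continuous (bowl p h) := by
  unfold bowl
  fun_prop

theorem sq_sub_norm_sq_pos (hx : x ∈ ball p h) : 0 < h ^ 2 - ‖x - p‖ ^ 2 := by
  rw [mem_ball, dist_eq_norm] at hx
  nlinarith [norm_nonneg (x - p)]

theorem contDiffOn_bowl : ContDiffOn ℝ 2 (bowl p h) (ball p h) := by
  unfold bowl
  refine contDiffOn_const.sub (ContDiffOn.sqrt ?_ fun x hx => (sq_sub_norm_sq_pos hx).ne')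
  exact contDiffOn_const.sub (((contDiff_id.sub contDiff_const).norm_sq ℝ).contDiffOn)

theorem hasFDerivAt_sqrt_sq_sub (hx : x ∈ ball p h) :
    HasFDerivAt (fun x => √(h ^ 2 - ‖x - p‖ ^ 2))
      (-((√(h ^ 2 - ‖x - p‖ ^ 2))⁻¹ • innerSL ℝ (x - p))) x := by
  have h1 := (((hasFDerivAt_id (𝕜 := ℝ) x).sub_const p).norm_sq.const_sub (h ^ 2)).sqrt
    (sq_sub_norm_sq_pos hx).ne'
  refine h1.congr_fderiv ?_
  ext v
  simp
  ring

theorem fderiv_bowl (hx : x ∈ ball p h) :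
    fderiv ℝ (bowl p h) x = (√(h ^ 2 - ‖x - p‖ ^ 2))⁻¹ • innerSL ℝ (x - p) := by
  have h2 := (hasFDerivAt_sqrt_sq_sub hx).const_sub h
  rw [neg_neg] at h2
  exact h2.fderiv

open Filter Topology in
theorem sndFDeriv_bowl (hx : x ∈ ball p h) (v w : EuclideanSpace ℝ (Fin n)) :
    fderiv ℝ (fderiv ℝ (bowl p h)) x v w = inner ℝ v w / √(h ^ 2 - ‖x - p‖ ^ 2) +
      inner ℝ (x - p) v * inner ℝ (x - p) w / √(h ^ 2 - ‖x - p‖ ^ 2) ^ 3 := by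
  have he : fderiv ℝ (bowl p h) =ᶠ[𝓝 x]
      fun y => (√(h ^ 2 - ‖y - p‖ ^ 2))⁻¹ • innerSL ℝ (y - p) := by
    filter_upwards [isOpen_ball.mem_nhds hx] with y hy using fderiv_bowl hy
  have hs : √(h ^ 2 - ‖x - p‖ ^ 2) ≠ 0 := (Real.sqrt_pos.2 (sq_sub_norm_sq_pos hx)).ne'
  have h1 := (hasDerivAt_inv hs).comp_hasFDerivAt x (hasFDerivAt_sqrt_sq_sub hx)
  have h2 : HasFDerivAt (fun y : EuclideanSpace ℝ (Fin n) => innerSL ℝ (y - p)) (innerSL ℝ) x :=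
    ((innerSL ℝ).hasFDerivAt.comp x ((hasFDerivAt_id x).sub_const p)).congr_fderiv
      (by ext; simp)
  have h3 : fderiv ℝ (fderiv ℝ (bowl p h)) x = _ := he.fderiv_eq.trans (h1.smul h2).fderiv
  rw [h3]
  simp [inner_sub_left]
  field_simp
  rfl

theorem gradient_bowl (hx : x ∈ ball p h) :
    gradient (bowl p h) x = (√(h ^ 2 - ‖x - p‖ ^ 2))⁻¹ • (x - p) := by
  refine ext_inner_right ℝ fun w => ?_
  rw [inner_gradient_eq_fderiv, fderiv_bowl hx]
  simp [inner_smul_left, inner_sub_left]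

theorem meanCurv_bowl (hh : 0 < h) (hx : x ∈ ball p h) : meanCurv (bowl p h) x = n / h := by
  have hpos := sq_sub_norm_sq_pos hx
  rw [meanCurv_eq, gradient_bowl hx]
  simp only [sndFDeriv_bowl hx]
  set s := √(h ^ 2 - ‖x - p‖ ^ 2) with hs
  have hs0 : 0 < s := Real.sqrt_pos.2 hpos
  have hss : s ^ 2 = h ^ 2 - ‖x - p‖ ^ 2 := Real.sq_sqrt hpos.le
  have hn : ‖s⁻¹ • (x - p)‖ ^ 2 = ‖x - p‖ ^ 2 / s ^ 2 := by
    rw [norm_smul, Real.norm_of_nonneg (by positivity)]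
    field_simp
  have h1 : 1 + ‖x - p‖ ^ 2 / s ^ 2 = (h / s) ^ 2 := by
    field_simp
    linarith
  have h2 : ∑ i : Fin n, inner ℝ (x - p) (EuclideanSpace.single i (1 : ℝ)) *
      inner ℝ (x - p) (EuclideanSpace.single i 1) = ‖x - p‖ ^ 2 := by
    rw [EuclideanSpace.real_norm_sq_eq]
    simp [EuclideanSpace.inner_single_right, pow_two]
  have h3 : ∑ i : Fin n, inner ℝ (EuclideanSpace.single i (1 : ℝ)) (EuclideanSpace.single i 1) =
      (n : ℝ) := by simp
  rw [hn, h1, Real.sqrt_sq (by positivity), Finset.sum_add_distrib, ← Finset.sum_div,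
    ← Finset.sum_div, h2, h3]
  simp only [inner_smul_left, inner_smul_right, real_inner_self_eq_norm_sq, RCLike.conj_to_real]
  have : ‖x - p‖ ^ 2 = h ^ 2 - s ^ 2 := by linarith
  rw [this]
  field_simp
  ring

theorem sq_div_le_bowl (hh : 0 < h) (hx : ‖x - p‖ ≤ h) : ‖x - p‖ ^ 2 / (2 * h) ≤ bowl p h x := by
  have h1 : √(h ^ 2 - ‖x - p‖ ^ 2) ≤ h - ‖x - p‖ ^ 2 / (2 * h) := by
    have h2 : ‖x - p‖ ^ 2 / (2 * h) ≤ h := by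
      rw [div_le_iff₀ (by positivity)]
      nlinarith [norm_nonneg (x - p)]
    refine Real.sqrt_le_iff.2 ⟨by linarith, ?_⟩
    have h3 : 2 * h * (‖x - p‖ ^ 2 / (2 * h)) = ‖x - p‖ ^ 2 := by field_simp
    nlinarith [sq_nonneg (‖x - p‖ ^ 2 / (2 * h))]
  unfold bowl
  linarith

theorem bowl_nonneg (hh : 0 < h) : 0 ≤ bowl p h x := by
  have : √(h ^ 2 - ‖x - p‖ ^ 2) ≤ h :=
    Real.sqrt_le_iff.2 ⟨hh.le, by nlinarith [sq_nonneg ‖x - p‖]⟩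
  unfold bowl
  linarith

theorem bowl_le_bowl {y : EuclideanSpace ℝ (Fin n)} (hxy : ‖x - p‖ ≤ ‖y - p‖) :
    bowl p h x ≤ bowl p h y := by
  unfold bowl
  gcongr

theorem bowl_self (hh : 0 < h) : bowl p h p = 0 := by
  simp [bowl, Real.sqrt_sq hh.le]

end Bowl

theorem nonpos_of_meanCurv_eq_zero {n : ℕ} (hn : 0 < n) {G : Set (EuclideanSpace ℝ (Fin n))}
    (hGo : IsOpen G) {R : ℝ} (hG : G ⊆ ball 0 R) {u : EuclideanSpace ℝ (Fin n) → ℝ}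
    (hu : ContDiffOn ℝ 2 u G) (huc : ContinuousOn u (closure G))
    (hH : ∀ x ∈ G, meanCurv u x = 0) (hb : ∀ x ∈ frontier G, u x = 0) : ∀ x ∈ G, u x ≤ 0 := by
  intro x hx
  have hR : 0 < R := by
    have := hG hx
    exact (norm_nonneg x).trans_lt (by simpa using this)
  refine le_of_forall_pos_le_add fun ε hε => ?_
  set h := R + R ^ 2 / ε with hh
  have hRh : R < h := by
    have : 0 < R ^ 2 / ε := by positivity
    linarith
  have hh0 : 0 < h := hR.trans hRh
  have hεh : R ^ 2 ≤ ε * h := by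
    have : ε * (R ^ 2 / ε) = R ^ 2 := by field_simp
    nlinarith
  have hGh : G ⊆ ball 0 h := hG.trans (ball_subset_ball hRh.le)
  have hbowl : ∀ y ∈ closure G, bowl 0 h y ≤ ε := by
    intro y hy
    have hy' : ‖y‖ ≤ R := by
      have := closure_ball_subset_closedBall (closure_mono hG hy)
      simpa using this
    have h1 : h - R ^ 2 / h ≤ √(h ^ 2 - ‖y - 0‖ ^ 2) := by
      refine Real.le_sqrt_of_sq_le ?_
      rw [sub_zero]
      have h2 : R ^ 2 / h ≤ h := by
        rw [div_le_iff₀ hh0]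
        nlinarith
      have h3 : h * (R ^ 2 / h) = R ^ 2 := by field_simp
      have h4 : 0 ≤ R ^ 2 / h := by positivity
      nlinarith [norm_nonneg y]
    have h2 : R ^ 2 / h ≤ ε := by rwa [div_le_iff₀ hh0]
    unfold bowl
    linarith
  have key := le_add_of_meanCurv_lt hGo (isBounded_ball.subset hG) hu
    (v := -bowl 0 h) ((contDiffOn_bowl.mono hGh).neg) huc continuous_bowl.neg.continuousOn
    (M := ε) ?_ ?_ x hx
  · have := bowl_nonneg (p := 0) (x := x) hh0
    simp only [Pi.neg_apply] at key
    linarith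
  · intro y hy
    rw [meanCurv_neg, meanCurv_bowl hh0 (hGh hy), hH y hy]
    have : 0 < (n : ℝ) / h := by positivity
    linarith
  · intro y hy
    rw [hb y hy]
    have := hbowl y (frontier_subset_closure hy)
    simp only [Pi.neg_apply]
    linarith

theorem nonpos_of_meanCurv_pos {n : ℕ} {G : Set (EuclideanSpace ℝ (Fin n))}
    (hGo : IsOpen G) (hG : Bornology.IsBounded G) {u : EuclideanSpace ℝ (Fin n) → ℝ}
    (hu : ContDiffOn ℝ 2 u G) (huc : ContinuousOn u (closure G))
    (hH : ∀ x ∈ G, 0 < meanCurv u x) (hb : ∀ x ∈ frontier G, u x = 0) :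
    ∀ x ∈ closure G, u x ≤ 0 := by
  intro x hx
  by_cases hxG : x ∈ G
  · have key := le_add_of_meanCurv_lt hGo hG hu (v := fun _ => 0) contDiffOn_const huc
      continuousOn_const (M := 0) ?_ (fun y hy => by simp [hb y hy]) x hxG
    · simpa using key
    · intro y hy
      rw [meanCurv_of_fderiv_eq_zero (by simp)]
      simpa using hH y hy
  · exact (hb x ⟨hx, by rwa [hGo.interior_eq]⟩).le

/-- The spherical annulus between the sphere of radius `R` about the origin and the sphere of
radius `ρ` about the point at height `a` on the `k`-th axis. -/
def annulus {n : ℕ} (k : Fin n) (a ρ R : ℝ) : Set (EuclideanSpace ℝ (Fin n)) :=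
  ball 0 R \ closedBall (a • EuclideanSpace.single k 1) ρ

/-- `u` solves the Dirichlet problem for constant mean curvature `H` in the annulus. -/
structure IsAnnulusSolution {n : ℕ} (k : Fin n) (a ρ R H : ℝ)
    (u : EuclideanSpace ℝ (Fin n) → ℝ) : Prop where
  a_pos : 0 < a
  ρ_pos : 0 < ρ
  add_lt : a + ρ < R
  H_pos : 0 < H
  contDiffOn : ContDiffOn ℝ 2 u (annulus k a ρ R)
  continuousOn : ContinuousOn u (closure (annulus k a ρ R))
  meanCurv_eq : ∀ x ∈ annulus k a ρ R, meanCurv u x = H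
  eq_zero : ∀ x ∈ frontier (annulus k a ρ R), u x = 0

section Annulus

variable {n : ℕ} {k : Fin n} {a ρ R H : ℝ} {u : EuclideanSpace ℝ (Fin n) → ℝ}
  {x y : EuclideanSpace ℝ (Fin n)}

theorem isOpen_annulus : IsOpen (annulus k a ρ R) := isOpen_ball.sdiff isClosed_closedBall

theorem isBounded_annulus : Bornology.IsBounded (annulus k a ρ R) :=
  isBounded_ball.subset sdiff_subset

theorem mem_annulus_iff :
    x ∈ annulus k a ρ R ↔ ‖x‖ < R ∧ ρ < ‖x - a • EuclideanSpace.single k 1‖ := by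
  simp [annulus, dist_eq_norm]

theorem le_of_mem_closure_annulus (hx : x ∈ closure (annulus k a ρ R)) :
    ‖x‖ ≤ R ∧ ρ ≤ ‖x - a • EuclideanSpace.single k 1‖ := by
  have hc : IsClosed {x : EuclideanSpace ℝ (Fin n) |
      ‖x‖ ≤ R ∧ ρ ≤ ‖x - a • EuclideanSpace.single k 1‖} := by
    refine IsClosed.and ?_ ?_
    · exact isClosed_le (by fun_prop) (by fun_prop)
    · exact isClosed_le (by fun_prop) (by fun_prop)
  refine closure_minimal (fun y hy => ?_) hc hx
  exact ⟨(mem_annulus_iff.1 hy).1.le, (mem_annulus_iff.1 hy).2.le⟩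

namespace IsAnnulusSolution

theorem nonpos (h : IsAnnulusSolution k a ρ R H u) :
    ∀ x ∈ closure (annulus k a ρ R), u x ≤ 0 :=
  nonpos_of_meanCurv_pos isOpen_annulus isBounded_annulus h.contDiffOn h.continuousOn
    (fun x hx => by rw [h.meanCurv_eq x hx]; exact h.H_pos) h.eq_zero

theorem eq_zero_of_notMem (h : IsAnnulusSolution k a ρ R H u)
    (hx : x ∈ closure (annulus k a ρ R)) (hx' : x ∉ annulus k a ρ R) : u x = 0 :=
  h.eq_zero x ⟨hx, by rwa [isOpen_annulus.interior_eq]⟩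

theorem contDiffAt (h : IsAnnulusSolution k a ρ R H u) (hx : x ∈ annulus k a ρ R) :
    ContDiffAt ℝ 2 u x :=
  h.contDiffOn.contDiffAt (isOpen_annulus.mem_nhds hx)

end IsAnnulusSolution

/-- Reflection in the hyperplane through `m` orthogonal to `e`. -/
def hyperplaneReflection (m e w : EuclideanSpace ℝ (Fin n)) : EuclideanSpace ℝ (Fin n) :=
  (ℝ ∙ e)ᗮ.reflection (w - m) + m

theorem hyperplaneReflection_eq (m e w : EuclideanSpace ℝ (Fin n)) :
    hyperplaneReflection m e w = w - (2 * (inner ℝ (w - m) e / ‖e‖ ^ 2)) • e := by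
  rw [hyperplaneReflection, Submodule.reflection_orthogonal_apply,
    Submodule.reflection_singleton_apply, real_inner_comm]
  simp only [RCLike.ofReal_real_eq_id, id]
  module

theorem norm_hyperplaneReflection_sub_sq {m e : EuclideanSpace ℝ (Fin n)} (he : e ≠ 0)
    (w q : EuclideanSpace ℝ (Fin n)) : ‖hyperplaneReflection m e w - q‖ ^ 2 =
      ‖w - q‖ ^ 2 - 4 * (inner ℝ (w - m) e / ‖e‖ ^ 2) * inner ℝ (m - q) e := by
  have hne : ‖e‖ ≠ 0 := norm_ne_zero_iff.2 he
  set t := inner ℝ (w - m) e / ‖e‖ ^ 2 with ht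
  have e1 : hyperplaneReflection m e w - q = (w - q) - (2 * t) • e := by
    rw [hyperplaneReflection_eq]
    module
  have e2 : inner ℝ (m - q) e = inner ℝ (w - q) e - t * ‖e‖ ^ 2 := by
    rw [ht, div_mul_cancel₀ _ (by positivity), ← inner_sub_left]
    congr 1
    abel
  rw [e1, norm_sub_sq_real, inner_smul_right, norm_smul, e2, mul_pow, Real.norm_eq_abs, sq_abs]
  ring

theorem continuous_hyperplaneReflection (m e : EuclideanSpace ℝ (Fin n)) :
    Continuous (hyperplaneReflection m e) := by
  unfold hyperplaneReflection
  fun_prop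

theorem IsAnnulusSolution.le_of_mem (h : IsAnnulusSolution k a ρ R H u) {c : ℝ} (hc0 : 0 ≤ c)
    (hca : c ≤ a) (hx : x ∈ annulus k a ρ R)
    (hd : ‖x - c • EuclideanSpace.single k 1‖ = ‖y - c • EuclideanSpace.single k 1‖)
    (hxy : y k ≤ x k) : y ∈ annulus k a ρ R ∧ u y ≤ u x := by
  rcases eq_or_ne x y with rfl | hne
  · exact ⟨hx, le_rfl⟩
  set m : EuclideanSpace ℝ (Fin n) := c • EuclideanSpace.single k 1 with hm
  set e := x - y with he
  have he0 : e ≠ 0 := sub_ne_zero.2 hne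
  have hne : 0 < ‖e‖ := norm_pos_iff.2 he0
  set σ := hyperplaneReflection m e with hσ
  have hinner : inner ℝ (x - m) e = ‖e‖ ^ 2 / 2 := by
    have h1 : y - m = (x - m) - e := by rw [he]; abel
    have h2 := norm_sub_sq_real (x - m) e
    rw [← h1, ← hd] at h2
    linarith
  have hσx : σ x = y := by
    rw [hσ, hyperplaneReflection_eq, hinner]
    have : 2 * (‖e‖ ^ 2 / 2 / ‖e‖ ^ 2) = 1 := by field_simp
    rw [this, he]
    module
  have hmq : ∀ d : ℝ, inner ℝ (m - d • EuclideanSpace.single k 1) e = (c - d) * (x k - y k) := by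
    intro d
    rw [hm, ← sub_smul, inner_smul_left, EuclideanSpace.inner_single_left]
    simp [he]
  set S : Set (EuclideanSpace ℝ (Fin n)) := {w | 0 < inner ℝ (w - m) e} with hS
  have hSo : IsOpen S := isOpen_lt continuous_const (by fun_prop)
  have hmem : ∀ w ∈ annulus k a ρ R, w ∈ S → σ w ∈ annulus k a ρ R := by
    intro w hw hwS
    obtain ⟨hw1, hw2⟩ := mem_annulus_iff.1 hw
    have ht : 0 < inner ℝ (w - m) e / ‖e‖ ^ 2 := div_pos hwS (by positivity)
    refine mem_annulus_iff.2 ⟨lt_of_le_of_lt (pow_le_pow_iff_left₀ (norm_nonneg _)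
      (norm_nonneg _) two_ne_zero |>.1 ?_) hw1, lt_of_lt_of_le hw2
      (pow_le_pow_iff_left₀ (norm_nonneg _) (norm_nonneg _) two_ne_zero |>.1 ?_)⟩
    · have h1 := norm_hyperplaneReflection_sub_sq (m := m) he0 w 0
      have h2 := hmq 0
      rw [zero_smul] at h2
      rw [h2, sub_zero, sub_zero] at h1
      have : 0 ≤ inner ℝ (w - m) e / ‖e‖ ^ 2 * ((c - 0) * (x k - y k)) :=
        mul_nonneg ht.le (mul_nonneg (by linarith) (by linarith))
      rw [hσ, h1]
      linarith
    · have h1 := norm_hyperplaneReflection_sub_sq (m := m) he0 w (a • EuclideanSpace.single k 1)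
      rw [hmq a] at h1
      have : 0 ≤ inner ℝ (w - m) e / ‖e‖ ^ 2 * ((a - c) * (x k - y k)) :=
        mul_nonneg ht.le (mul_nonneg (by linarith) (by linarith))
      rw [hσ, h1]
      linarith
  have hσc : Continuous σ := continuous_hyperplaneReflection m e
  set G := annulus k a ρ R ∩ S with hG
  have hxG : x ∈ G := ⟨hx, by simp only [hS, mem_ofPred_eq, hinner]; positivity⟩
  have hσG : ∀ w ∈ closure G, σ w ∈ closure (annulus k a ρ R) := fun w hw =>
    map_mem_closure hσc hw fun v hv => hmem v hv.1 hv.2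
  refine ⟨hσx ▸ hmem x hx hxG.2, ?_⟩
  set T := (ℝ ∙ e)ᗮ.reflection with hT
  have hσT : ∀ w, σ w = T w + (m - T m) := by
    intro w
    simp only [hσ, hyperplaneReflection, map_sub]
    abel
  have hσd : ContDiff ℝ 2 σ := by
    have : σ = fun w => T w + (m - T m) := funext hσT
    rw [this]
    exact T.toContinuousLinearEquiv.contDiff.add contDiff_const
  have key := le_add_of_meanCurv_eq (isOpen_annulus.inter hSo)
    (isBounded_annulus.subset inter_subset_left) (u := u ∘ σ) (v := u) (H := H) (M := 0)
    (h.contDiffOn.comp hσd.contDiffOn fun w hw => hmem w hw.1 hw.2)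
    (h.contDiffOn.mono inter_subset_left) (h.continuousOn.comp hσc.continuousOn hσG)
    (h.continuousOn.mono (closure_mono inter_subset_left)) h.H_pos ?_
    (fun w hw => h.meanCurv_eq w hw.1) ?_ x hxG
  · simpa [hσx] using key
  · intro w hw
    have h1 := meanCurv_comp_similarity one_pos T (b := m - T m) (x := w) (u := u)
      (by rw [one_smul, ← hσT]; exact h.contDiffAt (hmem w hw.1 hw.2))
    simp only [one_smul, inv_one, one_mul, ← hσT] at h1
    rw [← h.meanCurv_eq _ (hmem w hw.1 hw.2), ← h1]
    rfl
  · intro w hw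
    have hwc := frontier_subset_closure hw
    by_cases hwΩ : w ∈ annulus k a ρ R
    · have hwS : w ∉ S := fun hwS => by
        have := hw.2
        rw [(isOpen_annulus.inter hSo).interior_eq] at this
        exact this ⟨hwΩ, hwS⟩
      have h0 : 0 ≤ inner ℝ (w - m) e := by
        have hcl : IsClosed {w : EuclideanSpace ℝ (Fin n) | 0 ≤ inner ℝ (w - m) e} :=
          isClosed_le continuous_const (by fun_prop)
        have hsub : G ⊆ {w : EuclideanSpace ℝ (Fin n) | 0 ≤ inner ℝ (w - m) e} :=
          fun v hv => le_of_lt (show 0 < inner ℝ (v - m) e from hv.2)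
        exact closure_minimal hsub hcl hwc
      have h1 : inner ℝ (w - m) e = 0 := le_antisymm (not_lt.1 hwS) h0
      have : σ w = w := by
        rw [hσ, hyperplaneReflection_eq, h1]
        simp
      simp [this]
    · rw [h.eq_zero_of_notMem (closure_mono inter_subset_left hwc) hwΩ, zero_add]
      exact h.nonpos _ (hσG w hwc)

end Annulus

open Filter Topology in
theorem frequently_lt_of_hasDerivAt_ne_zero {f : ℝ → ℝ} {m : ℝ} (hf : HasDerivAt f m 0)
    (hm : m ≠ 0) : (∃ᶠ s in 𝓝[≠] 0, f s < f 0) ∧ ∃ᶠ s in 𝓝[≠] 0, f 0 < f s := by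
  have hs := hasDerivAt_iff_tendsto_slope.1 hf
  have hr : 𝓝[>] (0 : ℝ) ≤ 𝓝[≠] 0 := nhdsWithin_mono _ fun s hs => (ne_of_gt hs)
  have hl : 𝓝[<] (0 : ℝ) ≤ 𝓝[≠] 0 := nhdsWithin_mono _ fun s hs => (ne_of_lt hs)
  have hsl : ∀ s, slope f 0 s = (f s - f 0) / s := fun s => by simp [slope_def_field]
  rcases hm.lt_or_gt with hm | hm
  · have h := hs.eventually (gt_mem_nhds hm)
    constructor
    · refine Frequently.filter_mono (Eventually.frequently ?_) hr
      filter_upwards [hr h, self_mem_nhdsWithin] with s h1 h2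
      have h2 : 0 < s := h2
      have h1 : (f s - f 0) / s < 0 := hsl s ▸ h1
      rcases div_neg_iff.1 h1 with h3 | h3 <;> linarith [h3.1, h3.2]
    · refine Frequently.filter_mono (Eventually.frequently ?_) hl
      filter_upwards [hl h, self_mem_nhdsWithin] with s h1 h2
      have h2 : s < 0 := h2
      have h1 : (f s - f 0) / s < 0 := hsl s ▸ h1
      rcases div_neg_iff.1 h1 with h3 | h3 <;> linarith [h3.1, h3.2]
  · have h := hs.eventually (lt_mem_nhds hm)
    constructor
    · refine Frequently.filter_mono (Eventually.frequently ?_) hl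
      filter_upwards [hl h, self_mem_nhdsWithin] with s h1 h2
      have h2 : s < 0 := h2
      have h1 : 0 < (f s - f 0) / s := hsl s ▸ h1
      rcases div_pos_iff.1 h1 with h3 | h3 <;> linarith [h3.1, h3.2]
    · refine Frequently.filter_mono (Eventually.frequently ?_) hr
      filter_upwards [hr h, self_mem_nhdsWithin] with s h1 h2
      have h2 : 0 < s := h2
      have h1 : 0 < (f s - f 0) / s := hsl s ▸ h1
      rcases div_pos_iff.1 h1 with h3 | h3 <;> linarith [h3.1, h3.2]

/-- The circle about `m` through `x` with initial velocity `V`, when `V` is orthogonal to `x - m`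
and `l = ‖V‖ / ‖x - m‖`. -/
def circleCurve {n : ℕ} (m x V : EuclideanSpace ℝ (Fin n)) (l s : ℝ) : EuclideanSpace ℝ (Fin n) :=
  m + Real.cos (l * s) • (x - m) + (l⁻¹ * Real.sin (l * s)) • V

section Critical

variable {n : ℕ} {k : Fin n} {a ρ R H : ℝ} {u : EuclideanSpace ℝ (Fin n) → ℝ}
  {x y V : EuclideanSpace ℝ (Fin n)}

theorem hasDerivAt_circleCurve {m x V : EuclideanSpace ℝ (Fin n)} {l : ℝ} (hl : l ≠ 0) :
    HasDerivAt (circleCurve m x V l) V 0 := by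
  have h0 : HasDerivAt (fun s : ℝ => l * s) l 0 := by
    simpa using (hasDerivAt_id (0 : ℝ)).const_mul l
  have h1 := (h0.cos.smul_const (x - m)).const_add m
  have h2 := (h0.sin.const_mul l⁻¹).smul_const V
  refine (h1.add h2).congr_deriv ?_
  simp [hl]

theorem norm_circleCurve_sub {m x V : EuclideanSpace ℝ (Fin n)} (hV : V ≠ 0) (hxm : x - m ≠ 0)
    (hort : inner ℝ (x - m) V = 0) (s : ℝ) :
    ‖circleCurve m x V (‖V‖ / ‖x - m‖) s - m‖ = ‖x - m‖ := by
  have h1 : ‖V‖ ≠ 0 := norm_ne_zero_iff.2 hV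
  have h2 : ‖x - m‖ ≠ 0 := norm_ne_zero_iff.2 hxm
  rw [← sq_eq_sq₀ (norm_nonneg _) (norm_nonneg _)]
  set l := ‖V‖ / ‖x - m‖ with hl
  have e : circleCurve m x V l s - m =
      Real.cos (l * s) • (x - m) + (l⁻¹ * Real.sin (l * s)) • V := by
    rw [circleCurve]
    abel
  have hl2 : l⁻¹ ^ 2 * ‖V‖ ^ 2 = ‖x - m‖ ^ 2 := by
    rw [hl]
    field_simp
  rw [e, norm_add_sq_real, inner_smul_left, inner_smul_right, hort, norm_smul, norm_smul, mul_pow,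
    mul_pow, Real.norm_eq_abs, Real.norm_eq_abs, sq_abs, sq_abs, mul_pow]
  have := Real.sin_sq_add_cos_sq (l * s)
  linear_combination Real.sin (l * s) ^ 2 * hl2 + ‖x - m‖ ^ 2 * this

namespace IsAnnulusSolution

variable (h : IsAnnulusSolution k a ρ R H u) (hx : x ∈ annulus k a ρ R) (h0 : fderiv ℝ u x = 0)
  {c : ℝ} (hc0 : 0 ≤ c) (hca : c ≤ a) (hxc : x - c • EuclideanSpace.single k 1 ≠ 0)
  (hort : inner ℝ (x - c • EuclideanSpace.single k 1) V = 0)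

include h hx h0 hc0 hca hxc hort

open Filter Topology in
theorem sndFDeriv_nonpos_of_frequently (hV : V ≠ 0)
    (hfr : ∃ᶠ s in 𝓝[≠] 0, circleCurve (c • EuclideanSpace.single k 1) x V
      (‖V‖ / ‖x - c • EuclideanSpace.single k 1‖) s k ≤ x k) :
    fderiv ℝ (fderiv ℝ u) x V V ≤ 0 := by
  have hl : ‖V‖ / ‖x - c • EuclideanSpace.single k 1‖ ≠ 0 :=
    div_ne_zero (norm_ne_zero_iff.2 hV) (norm_ne_zero_iff.2 hxc)
  refine sndFDeriv_nonpos_of_curve (γ := circleCurve (c • EuclideanSpace.single k 1) x V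
    (‖V‖ / ‖x - c • EuclideanSpace.single k 1‖)) (h.contDiffAt hx) h0 (by simp [circleCurve])
    (hasDerivAt_circleCurve hl) (hfr.mono fun s hs => ?_)
  exact (h.le_of_mem hc0 hca hx (norm_circleCurve_sub hV hxc hort s).symm hs).2

open Filter Topology in
theorem sndFDeriv_nonneg_of_frequently (hV : V ≠ 0)
    (hfr : ∃ᶠ s in 𝓝[≠] 0, x k ≤ circleCurve (c • EuclideanSpace.single k 1) x V
      (‖V‖ / ‖x - c • EuclideanSpace.single k 1‖) s k) :
    0 ≤ fderiv ℝ (fderiv ℝ u) x V V := by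
  have hl : ‖V‖ / ‖x - c • EuclideanSpace.single k 1‖ ≠ 0 :=
    div_ne_zero (norm_ne_zero_iff.2 hV) (norm_ne_zero_iff.2 hxc)
  have hγ := hasDerivAt_circleCurve (m := c • EuclideanSpace.single k 1) (x := x) (V := V) hl
  have hγ0 : circleCurve (c • EuclideanSpace.single k 1) x V
      (‖V‖ / ‖x - c • EuclideanSpace.single k 1‖) 0 = x := by simp [circleCurve]
  have hev : ∀ᶠ s in 𝓝[≠] 0, circleCurve (c • EuclideanSpace.single k 1) x V
      (‖V‖ / ‖x - c • EuclideanSpace.single k 1‖) s ∈ annulus k a ρ R := by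
    refine (hγ.continuousAt.mono_left nhdsWithin_le_nhds).eventually ?_
    rw [hγ0]
    exact isOpen_annulus.mem_nhds hx
  refine sndFDeriv_nonneg_of_curve (h.contDiffAt hx) h0 hγ0 hγ ((hfr.and_eventually hev).mono ?_)
  rintro s ⟨hs, hs'⟩
  exact (h.le_of_mem hc0 hca hs' (norm_circleCurve_sub hV hxc hort s) hs).2

theorem sndFDeriv_eq_zero_of_apply_ne_zero (hVk : V k ≠ 0) :
    fderiv ℝ (fderiv ℝ u) x V V = 0 := by
  have hV : V ≠ 0 := fun hV => hVk (by simp [hV])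
  have hl : ‖V‖ / ‖x - c • EuclideanSpace.single k 1‖ ≠ 0 :=
    div_ne_zero (norm_ne_zero_iff.2 hV) (norm_ne_zero_iff.2 hxc)
  have hγ := hasDerivAt_circleCurve (m := c • EuclideanSpace.single k 1) (x := x) (V := V) hl
  have hγ0 : circleCurve (c • EuclideanSpace.single k 1) x V
      (‖V‖ / ‖x - c • EuclideanSpace.single k 1‖) 0 = x := by simp [circleCurve]
  have hk := (EuclideanSpace.proj (𝕜 := ℝ) k).hasFDerivAt.comp_hasDerivAt 0 hγ
  obtain ⟨h1, h2⟩ := frequently_lt_of_hasDerivAt_ne_zero hk hVk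
  simp only [Function.comp_apply, hγ0, PiLp.proj_apply] at h1 h2
  exact le_antisymm
    (h.sndFDeriv_nonpos_of_frequently hx h0 hc0 hca hxc hort hV (h1.mono fun _ hs => hs.le))
    (h.sndFDeriv_nonneg_of_frequently hx h0 hc0 hca hxc hort hV (h2.mono fun _ hs => hs.le))

open Filter in
theorem sndFDeriv_nonpos_of_le (hVk : V k = 0) (hcx : c ≤ x k) :
    fderiv ℝ (fderiv ℝ u) x V V ≤ 0 := by
  rcases eq_or_ne V 0 with rfl | hV
  · simp
  refine h.sndFDeriv_nonpos_of_frequently hx h0 hc0 hca hxc hort hV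
    (Eventually.frequently (Eventually.of_forall fun s => ?_))
  simp [circleCurve, hVk]
  nlinarith [Real.cos_le_one (‖V‖ / ‖x - c • EuclideanSpace.single k 1‖ * s)]

open Filter in
theorem sndFDeriv_nonneg_of_le (hVk : V k = 0) (hcx : x k ≤ c) :
    0 ≤ fderiv ℝ (fderiv ℝ u) x V V := by
  rcases eq_or_ne V 0 with rfl | hV
  · simp
  refine h.sndFDeriv_nonneg_of_frequently hx h0 hc0 hca hxc hort hV
    (Eventually.frequently (Eventually.of_forall fun s => ?_))
  simp [circleCurve, hVk]
  nlinarith [Real.cos_le_one (‖V‖ / ‖x - c • EuclideanSpace.single k 1‖ * s)]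

end IsAnnulusSolution

end Critical

namespace IsAnnulusSolution

variable {n : ℕ} {k : Fin n} {a ρ R H : ℝ} {u : EuclideanSpace ℝ (Fin n) → ℝ}
  {x : EuclideanSpace ℝ (Fin n)} {t : ℝ}

open Filter Topology in
theorem apply_eq_zero_of_fderiv_eq_zero (h : IsAnnulusSolution k a ρ R H u)
    (hx : x ∈ annulus k a ρ R) (h0 : fderiv ℝ u x = 0) {i : Fin n} (hi : i ≠ k) : x i = 0 := by
  by_contra hxi
  set e : EuclideanSpace ℝ (Fin n) := EuclideanSpace.single k 1 with he
  set x' := x - x k • e with hx'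
  have hx'i : x' i = x i := by simp [hx', he, hi]
  have hx'0 : x' ≠ 0 := fun hz => hxi (by rw [← hx'i, hz]; rfl)
  have hnorm : 0 < ‖x'‖ := norm_pos_iff.2 hx'0
  have hx'k : x' k = 0 := by simp [hx', he]
  have hinner : ∀ c (V : EuclideanSpace ℝ (Fin n)),
      inner ℝ (x - c • e) V = inner ℝ x' V + (x k - c) * V k := by
    intro c V
    have : x - c • e = x' + (x k - c) • e := by rw [hx']; module
    rw [this, inner_add_left, inner_smul_left, he, EuclideanSpace.inner_single_left]
    simp
  have hxc : ∀ c : ℝ, x - c • e ≠ 0 := by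
    intro c hc
    refine hxi ?_
    rw [sub_eq_zero.1 hc]
    simp [he, hi]
  set V₀ := e + ((a / 2 - x k) / ‖x'‖ ^ 2) • x' with hV₀
  have hV₀k : V₀ k = 1 := by simp [hV₀, he, hx'k]
  have hV₀i : inner ℝ x' V₀ = a / 2 - x k := by
    rw [hV₀, inner_add_right, inner_smul_right, real_inner_self_eq_norm_sq, he,
      EuclideanSpace.inner_single_right, hx'k]
    field_simp
    simp
  have hzero : ∀ W, fderiv ℝ (fderiv ℝ u) x W W = 0 := by
    intro W
    have hVk : Tendsto (fun s : ℝ => V₀ k + s * W k) (𝓝 0) (𝓝 1) := by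
      have hc : Continuous fun s : ℝ => V₀ k + s * W k := by fun_prop
      simpa [hV₀k] using hc.tendsto 0
    have hVi : Tendsto (fun s : ℝ => inner ℝ x' V₀ + s * inner ℝ x' W) (𝓝 0)
        (𝓝 (a / 2 - x k)) := by
      have hc : Continuous fun s : ℝ => inner ℝ x' V₀ + s * inner ℝ x' W := by fun_prop
      simpa [hV₀i] using hc.tendsto 0
    have hc := (hVi.div hVk one_ne_zero).const_add (x k)
    rw [div_one, add_sub_cancel] at hc
    have ha := h.a_pos
    have hev : ∀ᶠ s : ℝ in 𝓝 0, fderiv ℝ (fderiv ℝ u) x (V₀ + s • W) (V₀ + s • W) = 0 := by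
      filter_upwards [hc.eventually (Ioo_mem_nhds (half_pos ha) (half_lt_self ha)),
        hVk.eventually (isOpen_ne.mem_nhds one_ne_zero)] with s hs hs'
      have hsk : (V₀ + s • W) k = V₀ k + s * W k := by simp
      refine h.sndFDeriv_eq_zero_of_apply_ne_zero hx h0 hs.1.le hs.2.le (hxc _) ?_ ?_
      · rw [hinner, hsk, inner_add_right, inner_smul_right]
        have hs' : V₀ k + s * W k ≠ 0 := hs'
        simp only [Pi.div_apply]
        field_simp
        ring
      · rw [hsk]
        exact hs'
    obtain ⟨δ, hδ, hball⟩ := Metric.eventually_nhds_iff.1 hev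
    have h1 := @hball (δ / 2) (by simp [abs_of_pos hδ, hδ])
    have h2 := @hball (-(δ / 2)) (by simp [abs_of_pos hδ, hδ])
    have h3 := @hball 0 (by simpa using hδ)
    simp only [map_add, map_smul, add_apply, smul_apply, smul_eq_mul] at h1 h2 h3
    have h4 : δ ^ 2 * fderiv ℝ (fderiv ℝ u) x W W = 0 := by
      linear_combination 2 * h1 + 2 * h2 - 4 * h3
    rcases mul_eq_zero.1 h4 with h5 | h5
    · exact absurd h5 (by positivity)
    · exact h5
  have hH := h.meanCurv_eq x hx
  rw [meanCurv_of_fderiv_eq_zero h0] at hH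
  simp only [hzero, Finset.sum_const_zero] at hH
  exact h.H_pos.ne hH

theorem eq_smul_of_fderiv_eq_zero (h : IsAnnulusSolution k a ρ R H u)
    (hx : x ∈ annulus k a ρ R) (h0 : fderiv ℝ u x = 0) : x = x k • EuclideanSpace.single k 1 := by
  ext i
  rcases eq_or_ne i k with rfl | hi
  · simp
  · simp [h.apply_eq_zero_of_fderiv_eq_zero hx h0 hi, hi]

theorem inner_axis_eq_zero (c : ℝ) {i : Fin n} (hi : i ≠ k) :
    inner ℝ (t • EuclideanSpace.single k 1 - c • EuclideanSpace.single k (1 : ℝ))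
      (EuclideanSpace.single i 1) = 0 := by
  rw [← sub_smul, inner_smul_left, EuclideanSpace.inner_single_left]
  simp [hi.symm]

theorem axis_sub_ne_zero {c : ℝ} (hc : t ≠ c) :
    t • EuclideanSpace.single k 1 - c • EuclideanSpace.single k (1 : ℝ) ≠ 0 := by
  rw [← sub_smul]
  simpa [sub_eq_zero] using hc

theorem sndFDeriv_axis_eq (h : IsAnnulusSolution k a ρ R H u)
    (hx : x ∈ annulus k a ρ R) (h0 : fderiv ℝ u x = 0) :
    fderiv ℝ (fderiv ℝ u) x (EuclideanSpace.single k 1) (EuclideanSpace.single k 1) =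
      H - ∑ i ∈ Finset.univ.erase k,
        fderiv ℝ (fderiv ℝ u) x (EuclideanSpace.single i 1) (EuclideanSpace.single i 1) := by
  rw [← h.meanCurv_eq x hx, meanCurv_of_fderiv_eq_zero h0,
    ← Finset.add_sum_erase _ _ (Finset.mem_univ k)]
  ring

theorem sndFDeriv_axis_pos_of_gt (h : IsAnnulusSolution k a ρ R H u)
    (hx : t • EuclideanSpace.single k 1 ∈ annulus k a ρ R)
    (h0 : fderiv ℝ u (t • EuclideanSpace.single k 1) = 0) (ht : a < t) :
    0 < fderiv ℝ (fderiv ℝ u) (t • EuclideanSpace.single k 1)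
      (EuclideanSpace.single k 1) (EuclideanSpace.single k 1) := by
  rw [h.sndFDeriv_axis_eq hx h0]
  have := Finset.sum_nonpos fun i (hi : i ∈ Finset.univ.erase k) =>
    h.sndFDeriv_nonpos_of_le hx h0 h.a_pos.le le_rfl (axis_sub_ne_zero ht.ne')
      (inner_axis_eq_zero a (Finset.ne_of_mem_erase hi))
      (by simp [(Finset.ne_of_mem_erase hi).symm]) (by simpa using ht.le)
  linarith [h.H_pos]

theorem hasDerivAt_axis (t : ℝ) :
    HasDerivAt (fun s : ℝ => (t + s) • EuclideanSpace.single k (1 : ℝ))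
      (EuclideanSpace.single k 1) 0 := by
  simpa using ((hasDerivAt_id (0 : ℝ)).const_add t).smul_const (EuclideanSpace.single k (1 : ℝ))

open Filter Topology in
theorem fderiv_ne_zero_of_mem_Ioo (h : IsAnnulusSolution k a ρ R H u)
    (hx : t • EuclideanSpace.single k 1 ∈ annulus k a ρ R) (ht : t ∈ Ioo 0 a) :
    fderiv ℝ u (t • EuclideanSpace.single k 1) ≠ 0 := by
  intro h0
  have hzero : ∀ i ∈ Finset.univ.erase k,
      fderiv ℝ (fderiv ℝ u) (t • EuclideanSpace.single k 1)
        (EuclideanSpace.single i 1) (EuclideanSpace.single i 1) = 0 := by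
    intro i hi
    refine le_antisymm ?_ ?_
    · exact h.sndFDeriv_nonpos_of_le hx h0 le_rfl h.a_pos.le (axis_sub_ne_zero ht.1.ne')
        (inner_axis_eq_zero 0 (Finset.ne_of_mem_erase hi))
        (by simp [(Finset.ne_of_mem_erase hi).symm]) (by simpa using ht.1.le)
    · exact h.sndFDeriv_nonneg_of_le hx h0 h.a_pos.le le_rfl (axis_sub_ne_zero ht.2.ne)
        (inner_axis_eq_zero a (Finset.ne_of_mem_erase hi))
        (by simp [(Finset.ne_of_mem_erase hi).symm]) (by simpa using ht.2.le)
  have h1 := h.sndFDeriv_axis_eq hx h0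
  rw [Finset.sum_eq_zero hzero, sub_zero] at h1
  have h2 := sndFDeriv_nonpos_of_curve (h.contDiffAt hx) h0 (by simp)
    (hasDerivAt_axis (k := k) t) ?_
  · linarith [h.H_pos]
  · have hl : 𝓝[<] (0 : ℝ) ≤ 𝓝[≠] 0 := nhdsWithin_mono _ fun s hs => (ne_of_lt hs)
    refine Frequently.filter_mono (Eventually.frequently ?_) hl
    filter_upwards [Ioo_mem_nhdsLT (a := -t) (by linarith [ht.1])] with s hs
    refine (h.le_of_mem (c := t + s / 2) (by linarith [hs.1, ht.1]) (by linarith [hs.2, ht.2])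
      hx ?_ (by simpa using hs.2.le)).2
    rw [← sub_smul, ← sub_smul, norm_smul, norm_smul]
    congr 1
    rw [Real.norm_eq_abs, Real.norm_eq_abs, ← abs_neg]
    congr 1
    ring

end IsAnnulusSolution

section Meridian

variable {n : ℕ} {k j : Fin n} {s : ℝ}

theorem norm_sub_axis_sq (k : Fin n) (x : EuclideanSpace ℝ (Fin n)) (t : ℝ) :
    ‖x - t • EuclideanSpace.single k 1‖ ^ 2 = ‖x‖ ^ 2 - 2 * t * x k + t ^ 2 := by
  rw [norm_sub_sq_real, inner_smul_right, EuclideanSpace.inner_single_right, norm_smul]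
  simp
  ring

/-- The distance from the axis and the height, up to the sign `s`, as a complex number. -/
def meridianProj (k : Fin n) (s : ℝ) (x : EuclideanSpace ℝ (Fin n)) : ℂ :=
  ⟨‖x - x k • EuclideanSpace.single k 1‖, s * x k⟩

/-- The embedding of the plane into the span of two coordinate axes. -/
def meridianSection (j k : Fin n) (s : ℝ) (w : ℂ) : EuclideanSpace ℝ (Fin n) :=
  w.re • EuclideanSpace.single j 1 + (s * w.im) • EuclideanSpace.single k 1

theorem continuous_meridianProj (k : Fin n) (s : ℝ) : Continuous (meridianProj k s) := by
  have : meridianProj k s = fun x => ((‖x - x k • EuclideanSpace.single k 1‖ : ℝ) : ℂ) +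
      ((s * x k : ℝ) : ℂ) * Complex.I := by
    funext x
    apply Complex.ext <;> simp [meridianProj]
  rw [this]
  fun_prop

theorem continuous_meridianSection (j k : Fin n) (s : ℝ) :
    Continuous (meridianSection j k s) := by
  unfold meridianSection
  fun_prop

theorem meridianSection_apply (hjk : j ≠ k) (w : ℂ) : meridianSection j k s w k = s * w.im := by
  simp [meridianSection, hjk.symm]

theorem norm_meridianSection_sq (hjk : j ≠ k) (hs : s ^ 2 = 1) (w : ℂ) :
    ‖meridianSection j k s w‖ ^ 2 = w.re ^ 2 + w.im ^ 2 := by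
  rw [meridianSection, norm_add_sq_real, inner_smul_left, inner_smul_right,
    EuclideanSpace.inner_single_left, norm_smul, norm_smul]
  simp [hjk, mul_pow, hs]

theorem meridianProj_re_sq (x : EuclideanSpace ℝ (Fin n)) :
    (meridianProj k s x).re ^ 2 = ‖x‖ ^ 2 - x k ^ 2 := by
  rw [meridianProj, norm_sub_axis_sq]
  ring

theorem meridianSection_meridianProj (hjk : j ≠ k) (hs : s ^ 2 = 1)
    (x : EuclideanSpace ℝ (Fin n)) :
    meridianSection j k s (meridianProj k s x) k = x k ∧
      ‖meridianSection j k s (meridianProj k s x)‖ = ‖x‖ := by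
  constructor
  · rw [meridianSection_apply hjk]
    simp only [meridianProj]
    linear_combination x k * hs
  · rw [← pow_left_inj₀ (norm_nonneg _) (norm_nonneg _) two_ne_zero,
      norm_meridianSection_sq hjk hs, meridianProj_re_sq]
    simp only [meridianProj]
    linear_combination x k ^ 2 * hs

theorem dist_meridianProj (hs : s ^ 2 = 1) (x : EuclideanSpace ℝ (Fin n)) (t : ℝ) :
    dist (meridianProj k s x) ((s * t : ℝ) * Complex.I) =
      ‖x - t • EuclideanSpace.single k 1‖ := by
  rw [dist_eq_norm, ← pow_left_inj₀ (norm_nonneg _) (norm_nonneg _) two_ne_zero,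
    Complex.sq_norm, Complex.normSq_apply, norm_sub_axis_sq]
  have h1 := meridianProj_re_sq (k := k) (s := s) x
  have h2 : (meridianProj k s x).im = s * x k := rfl
  simp only [Complex.sub_re, Complex.sub_im, Complex.mul_re, Complex.mul_im, Complex.ofReal_re,
    Complex.ofReal_im, Complex.I_re, Complex.I_im, h2]
  linear_combination h1 + (x k - t) ^ 2 * hs

theorem meridianProj_axis (t : ℝ) :
    meridianProj k s (t • EuclideanSpace.single k 1) = (s * t : ℝ) * Complex.I := by
  apply Complex.ext <;> simp [meridianProj]

/-- The planar separation principle for sets in space, on which an axially symmetric function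
is positive and negative respectively. -/
theorem axial_separation (hjk : j ≠ k) (hs : s ^ 2 = 1) {C : Set (EuclideanSpace ℝ (Fin n))}
    (hC : IsClosed C) {D : EuclideanSpace ℝ (Fin n) → ℝ} (hDc : ContinuousOn D C)
    (hD : ∀ x ∈ C, ∀ y : EuclideanSpace ℝ (Fin n), y k = x k → ‖y‖ = ‖x‖ → y ∈ C ∧ D y = D x)
    {E N : Set (EuclideanSpace ℝ (Fin n))} (hEC : E ⊆ C) (hNC : N ⊆ C)
    (hE : IsPathConnected E) (hN : IsPathConnected N) (hEpos : ∀ x ∈ E, 0 < D x)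
    (hNneg : ∀ x ∈ N, D x < 0) {t τ : ℝ} (hτ : 0 < τ)
    (hp : t • EuclideanSpace.single k 1 ∈ E) (hq : (t - s * τ) • EuclideanSpace.single k 1 ∈ N)
    {o y : EuclideanSpace ℝ (Fin n)} (ho : o ∈ closure E) (hy : y ∈ closure N)
    (hDo : 0 < D o) (hDy : D y < 0) (hτo : τ < ‖o - t • EuclideanSpace.single k 1‖)
    (hEy : ∀ x ∈ E, ‖x - t • EuclideanSpace.single k 1‖ < ‖y - t • EuclideanSpace.single k 1‖)
    (harc : ∀ x : EuclideanSpace ℝ (Fin n),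
      ‖x - t • EuclideanSpace.single k 1‖ = ‖o - t • EuclideanSpace.single k 1‖ →
      s * x k ≤ s * o k → x ∉ N ∧ x ≠ y) : False := by
  set P := meridianProj k s with hP
  set S := meridianSection j k s with hS
  have hPc : Continuous P := continuous_meridianProj k s
  have hSc : Continuous S := continuous_meridianSection j k s
  have hSP : ∀ x ∈ C, S (P x) ∈ C ∧ D (S (P x)) = D x := fun x hx =>
    hD x hx _ (meridianSection_meridianProj hjk hs x).1 (meridianSection_meridianProj hjk hs x).2
  have hoC : o ∈ C := closure_minimal hEC hC ho
  have hyC : y ∈ C := closure_minimal hNC hC hy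
  have hcl : ∀ (A : Set (EuclideanSpace ℝ (Fin n))) (F : Set ℝ), IsClosed F → A ⊆ C →
      (∀ x ∈ A, D x ∈ F) → ∀ x ∈ C, P x ∈ closure (P '' A) → D x ∈ F := by
    intro A F hF hA hAF x hx hxA
    have h1 : IsClosed (C ∩ D ⁻¹' F) := hDc.preimage_isClosed_of_isClosed hC hF
    have h2 : S (P x) ∈ C ∩ D ⁻¹' F := by
      refine closure_minimal ?_ h1 (map_mem_closure hSc hxA (t := C ∩ D ⁻¹' F) ?_)
      · exact subset_rfl
      · rintro _ ⟨v, hv, rfl⟩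
        have := hSP v (hA hv)
        exact ⟨this.1, by rw [mem_preimage, this.2]; exact hAF v hv⟩
    have h3 : D (S (P x)) ∈ F := h2.2
    rwa [(hSP x hx).2] at h3
  have hPre : ∀ x, 0 ≤ (P x).re := fun x => norm_nonneg _
  have hdist : ∀ x, dist (P x) ((s * t : ℝ) * Complex.I) =
    ‖x - t • EuclideanSpace.single k 1‖ := fun x => dist_meridianProj hs x t
  refine planar_separation (t₀ := s * t) (τ := τ) hτ (E := P '' E) (N := P '' N)
    (hE.image hPc) (hN.image hPc) ?_ ?_ ?_ ⟨_, hp, meridianProj_axis t⟩ ⟨_, hq, ?_⟩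
    (o := P o) (y := P y) (map_mem_closure hPc ho (mapsTo_image _ _))
    (map_mem_closure hPc hy (mapsTo_image _ _)) (hPre o) (hPre y) ?_ ?_ ?_ ?_ ?_
  · rintro _ ⟨x, -, rfl⟩
    exact hPre x
  · rintro _ ⟨x, -, rfl⟩
    exact hPre x
  · rw [Set.disjoint_left]
    rintro _ ⟨x, hx, rfl⟩ ⟨x', hx', hxx⟩
    have h1 := (hSP x (hEC hx)).2
    have h2 := (hSP x' (hNC hx')).2
    rw [hxx, h1] at h2
    linarith [hEpos x hx, hNneg x' hx']
  · rw [hP, meridianProj_axis]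
    congr 2
    linear_combination -τ * hs
  · intro hc
    exact absurd (hcl N (Iic 0) isClosed_Iic hNC (fun x hx => (hNneg x hx).le) o hoC hc)
      (not_le.2 hDo)
  · intro hc
    exact absurd (hcl E (Ici 0) isClosed_Ici hEC (fun x hx => (hEpos x hx).le) y hyC hc)
      (not_le.2 hDy)
  · rwa [hdist]
  · rintro _ ⟨x, hx, rfl⟩
    rw [hdist, hdist]
    exact hEy x hx
  · intro w hw hd him
    rw [hdist] at hd
    have hyo : ‖y - t • EuclideanSpace.single k 1‖ = ‖o - t • EuclideanSpace.single k 1‖ →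
        s * y k ≤ s * o k → False := fun h1 h2 => (harc y h1 h2).2 rfl
    refine ⟨?_, ?_, ?_⟩
    · rintro ⟨x, hx, rfl⟩
      rw [hdist] at hd
      exact (harc x hd him).1 hx
    · rintro rfl
      rw [hdist] at hd
      exact hyo hd him
    · rintro ⟨h1, h2⟩
      rw [hd, hdist] at h1
      exact hyo h1.symm (h2.trans him)

end Meridian

section Components

variable {n : ℕ} {u v : EuclideanSpace ℝ (Fin n) → ℝ} {p o : EuclideanSpace ℝ (Fin n)} {h H : ℝ}

theorem meanCurv_add_const (u : EuclideanSpace ℝ (Fin n) → ℝ) (c : ℝ)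
    (x : EuclideanSpace ℝ (Fin n)) : meanCurv (fun y => u y + c) x = meanCurv u x := by
  have h1 : fderiv ℝ (fun y => u y + c) = fderiv ℝ u := funext fun y => fderiv_add_const c
  rw [meanCurv_eq, meanCurv_eq, gradient_eq_of_fderiv_eq (congrFun h1 x), h1]

/-- On a connected component of `{v < u}`, the difference of two functions of the same mean
curvature is largest at a point outside the domain. -/
theorem exists_component_of_meanCurv_eq {G : Set (EuclideanSpace ℝ (Fin n))} (hGo : IsOpen G)
    (hGb : Bornology.IsBounded G) (hu : ContDiffOn ℝ 2 u G) (hv : ContDiffOn ℝ 2 v G)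
    (huc : ContinuousOn u (closure G)) (hvc : ContinuousOn v (closure G)) (hH : 0 < H)
    (hHu : ∀ x ∈ G, meanCurv u x = H) (hHv : ∀ x ∈ G, meanCurv v x = H) (hp : p ∈ G)
    (hvu : v p < u p) :
    ∃ E : Set (EuclideanSpace ℝ (Fin n)), IsPathConnected E ∧ p ∈ E ∧ E ⊆ G ∧
      (∀ x ∈ E, v x < u x) ∧
      (∀ A, IsPreconnected A → A ⊆ G → (∀ x ∈ A, v x < u x) → (A ∩ E).Nonempty → A ⊆ E) ∧
      ∃ o ∈ closure E, o ∉ G ∧ v o < u o ∧ ∀ x ∈ E, u x - v x ≤ u o - v o := by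
  set U := {x ∈ G | v x < u x} with hU
  have hUo : IsOpen U := by
    have heq : U = G ∩ (v - u) ⁻¹' Iio 0 := by
      ext x
      simp [hU]
    rw [heq]
    exact (hv.continuousOn.sub hu.continuousOn).isOpen_inter_preimage hGo isOpen_Iio
  have hpU : p ∈ U := ⟨hp, hvu⟩
  set E := connectedComponentIn U p with hE
  have hEo : IsOpen E := hUo.connectedComponentIn
  have hpE : p ∈ E := mem_connectedComponentIn hpU
  have hEU : E ⊆ U := connectedComponentIn_subset U p
  have hEG : E ⊆ G := fun x hx => (hEU hx).1
  have hEmax : ∀ A, IsPreconnected A → A ⊆ G → (∀ x ∈ A, v x < u x) → (A ∩ E).Nonempty →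
      A ⊆ E := by
    rintro A hA hAG hAlt ⟨w, hwA, hwE⟩
    rw [hE, connectedComponentIn_eq hwE]
    exact hA.subset_connectedComponentIn hwA fun x hx => ⟨hAG hx, hAlt x hx⟩
  have hEcl : closure E ⊆ closure G := closure_mono hEG
  have hmax : ∀ M, (∀ x ∈ frontier E, u x ≤ v x + M) → ∀ x ∈ E, u x ≤ v x + M := fun M hM =>
    le_add_of_meanCurv_eq hEo (hGb.subset hEG) (hu.mono hEG) (hv.mono hEG) (huc.mono hEcl)
      (hvc.mono hEcl) hH (fun x hx => hHu x (hEG hx)) (fun x hx => hHv x (hEG hx)) hM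
  have hne : (frontier E).Nonempty := by
    by_contra hne
    rw [not_nonempty_iff_eq_empty] at hne
    have := hmax 0 (by simp [hne]) p hpE
    linarith
  have hcpt : IsCompact (frontier E) :=
    ((hGb.subset hEG).isCompact_closure).of_isClosed_subset isClosed_frontier
      frontier_subset_closure
  obtain ⟨o, ho, hmo⟩ := hcpt.exists_isMaxOn hne
    ((huc.sub hvc).mono (frontier_subset_closure.trans hEcl))
  have hmo' : ∀ x ∈ E, u x ≤ v x + (u o - v o) := hmax _ fun x hx => by
    have := isMaxOn_iff.1 hmo x hx
    simp only [Pi.sub_apply] at this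
    linarith
  have hvo : v o < u o := by linarith [hmo' p hpE]
  have hoE : o ∉ E := by
    have := ho.2
    rwa [hEo.interior_eq] at this
  refine ⟨E, ⟨(hEo.isConnected_iff_isPathConnected.1
    ⟨⟨p, hpE⟩, isPreconnected_connectedComponentIn⟩).choose, ?_⟩, hpE, hEG,
    fun x hx => (hEU hx).2, hEmax, o, frontier_subset_closure ho, fun hoG => hoE ?_, hvo,
    fun x hx => by linarith [hmo' x hx]⟩
  · exact (hEo.isConnected_iff_isPathConnected.1
      ⟨⟨p, hpE⟩, isPreconnected_connectedComponentIn⟩).choose_spec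
  · obtain ⟨ε, hε, hball⟩ := Metric.isOpen_iff.1 hUo o ⟨hoG, hvo⟩
    obtain ⟨w, hwE, hw⟩ := Metric.mem_closure_iff.1 (frontier_subset_closure ho) ε hε
    exact hEmax (ball o ε) (convex_ball o ε).isPreconnected (fun x hx => (hball hx).1)
      (fun x hx => (hball hx).2) ⟨w, by rwa [mem_ball, dist_comm], hwE⟩ (mem_ball_self hε)

open Filter Topology in
/-- At the rim of a lower hemisphere the slope is infinite. -/
theorem not_eventually_sub_bowl_le (hh : 0 < h) (ho : ‖o - p‖ = h)
    (hu : DifferentiableAt ℝ u o) :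
    ¬ ∀ᶠ s : ℝ in 𝓝[>] 0, u (o - s • (o - p)) - bowl p h (o - s • (o - p)) ≤
      u o - bowl p h o := by
  intro hev
  have hγ : DifferentiableAt ℝ (fun s : ℝ => u (o - s • (o - p))) 0 := by
    refine DifferentiableAt.comp (g := u) (0 : ℝ) ?_ (by fun_prop)
    simpa using hu
  obtain ⟨C, hC, hbd⟩ := (hγ.isBigO_sub.mono nhdsWithin_le_nhds (f := fun s : ℝ =>
    u (o - s • (o - p)) - u (o - (0 : ℝ) • (o - p))) (l := 𝓝[>] (0 : ℝ))).exists_pos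
  rw [Asymptotics.isBigOWith_iff] at hbd
  have hsm : ∀ᶠ s : ℝ in 𝓝[>] 0, s < min 1 ((h / C) ^ 2) :=
    (eventually_lt_nhds (by positivity)).filter_mono nhdsWithin_le_nhds
  obtain ⟨s, hs1, hs2, hs3, hs0⟩ :=
    (hev.and (hbd.and (hsm.and self_mem_nhdsWithin))).exists
  have hs0 : 0 < s := hs0
  obtain ⟨hs3, hs4⟩ := lt_min_iff.1 hs3
  rw [zero_smul, sub_zero, sub_zero, Real.norm_eq_abs, Real.norm_eq_abs, abs_of_pos hs0] at hs2
  have h1 : o - s • (o - p) - p = (1 - s) • (o - p) := by module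
  have h2 : bowl p h o = h := by simp [bowl, ho]
  have h3 : h * √s ≤ √(h ^ 2 - ‖o - s • (o - p) - p‖ ^ 2) := by
    refine Real.le_sqrt_of_sq_le ?_
    rw [h1, norm_smul, ho, mul_pow, mul_pow, Real.sq_sqrt hs0.le, Real.norm_eq_abs, sq_abs]
    have : 0 ≤ h ^ 2 * (s * (1 - s)) := by
      have : 0 < 1 - s := by linarith
      positivity
    nlinarith
  have h4 : bowl p h (o - s • (o - p)) ≤ h - h * √s := by
    unfold bowl
    linarith
  have h5 : h * √s ≤ C * s := by linarith [neg_abs_le (u (o - s • (o - p)) - u o)]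
  have h6 : C * √s < h := by
    have h7 : √s < h / C := (Real.sqrt_lt' (by positivity)).2 hs4
    rwa [lt_div_iff₀ hC, mul_comm] at h7
  have h8 : 0 < √s := Real.sqrt_pos.2 hs0
  have h9 : √s * √s = s := Real.mul_self_sqrt hs0.le
  nlinarith

end Components

namespace IsAnnulusSolution

variable {n : ℕ} {k j : Fin n} {a ρ R H : ℝ} {u : EuclideanSpace ℝ (Fin n) → ℝ}
  {x y : EuclideanSpace ℝ (Fin n)} {t : ℝ}

theorem eq_of_apply_eq (h : IsAnnulusSolution k a ρ R H u) (hx : x ∈ annulus k a ρ R)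
    (hk : y k = x k) (hn : ‖y‖ = ‖x‖) : y ∈ annulus k a ρ R ∧ u y = u x := by
  have h1 := h.le_of_mem (y := y) le_rfl h.a_pos.le hx (by simp [hn]) hk.le
  have h2 := h.le_of_mem (y := x) le_rfl h.a_pos.le h1.1 (by simp [hn]) hk.ge
  exact ⟨h1.1, le_antisymm h1.2 h2.2⟩

theorem norm_sub_axis_eq (hk : y k = x k) (hn : ‖y‖ = ‖x‖) (c : ℝ) :
    ‖y - c • EuclideanSpace.single k 1‖ = ‖x - c • EuclideanSpace.single k 1‖ := by
  rw [← pow_left_inj₀ (norm_nonneg _) (norm_nonneg _) two_ne_zero, norm_sub_axis_sq,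
    norm_sub_axis_sq, hk, hn]

theorem closure_annulus (h : IsAnnulusSolution k a ρ R H u) : closure (annulus k a ρ R) =
    {x | ‖x‖ ≤ R ∧ ρ ≤ ‖x - a • EuclideanSpace.single k 1‖} := by
  refine Subset.antisymm (fun x hx => le_of_mem_closure_annulus hx) ?_
  rintro x ⟨h1, h2⟩
  have hR : 0 < R := by linarith [h.a_pos, h.ρ_pos, h.add_lt]
  set z : EuclideanSpace ℝ (Fin n) := a • EuclideanSpace.single k 1 with hz
  have hznorm : ‖z‖ = a := by simp [hz, norm_smul, abs_of_pos h.a_pos]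
  rcases h1.lt_or_eq with h1 | h1
  · have hx : x ∈ closure (closedBall z ρ)ᶜ := by
      rw [closure_compl, interior_closedBall z h.ρ_pos.ne']
      simpa [dist_eq_norm] using h2
    rw [annulus, sdiff_eq_compl_inter, inter_comm]
    exact isOpen_ball.inter_closure ⟨by simpa using h1, hx⟩
  · have hx : x ∈ closure (ball (0 : EuclideanSpace ℝ (Fin n)) R) := by
      rw [closure_ball _ hR.ne']
      simp [h1]
    rw [annulus, sdiff_eq_compl_inter]
    refine isClosed_closedBall.isOpen_compl.inter_closure ⟨?_, hx⟩
    have := norm_sub_norm_le x z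
    rw [mem_compl_iff, mem_closedBall, dist_eq_norm]
    linarith [h.add_lt]

theorem eq_of_apply_eq_of_mem_closure (h : IsAnnulusSolution k a ρ R H u)
    (hx : x ∈ closure (annulus k a ρ R)) (hk : y k = x k) (hn : ‖y‖ = ‖x‖) :
    y ∈ closure (annulus k a ρ R) ∧ u y = u x := by
  have hy : y ∈ closure (annulus k a ρ R) := by
    rw [h.closure_annulus] at hx ⊢
    exact ⟨hn ▸ hx.1, (norm_sub_axis_eq hk hn a).symm ▸ hx.2⟩
  refine ⟨hy, ?_⟩
  by_cases hxΩ : x ∈ annulus k a ρ R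
  · exact (h.eq_of_apply_eq hxΩ hk hn).2
  · have hyΩ : y ∉ annulus k a ρ R := fun hyΩ =>
      hxΩ (h.eq_of_apply_eq hyΩ hk.symm hn.symm).1
    rw [h.eq_zero_of_notMem hx hxΩ, h.eq_zero_of_notMem hy hyΩ]

open Filter Topology in
theorem sndFDeriv_axis_pos_of_neg (h : IsAnnulusSolution k a ρ R H u) (hjk : j ≠ k)
    (hx : t • EuclideanSpace.single k 1 ∈ annulus k a ρ R)
    (h0 : fderiv ℝ u (t • EuclideanSpace.single k 1) = 0) (ht : t < 0) :
    0 < fderiv ℝ (fderiv ℝ u) (t • EuclideanSpace.single k 1)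
      (EuclideanSpace.single k 1) (EuclideanSpace.single k 1) := by
  by_contra hB
  rw [not_lt] at hB
  set p : EuclideanSpace ℝ (Fin n) := t • EuclideanSpace.single k 1 with hp
  have hn : (0 : ℝ) < n := Nat.cast_pos.2 k.pos
  have hH := h.H_pos
  set b := n / H with hb
  have hb0 : 0 < b := by positivity
  have hnb : n / b = H := by rw [hb]; field_simp
  have hlim := tendsto_sub_div_sq_of_fderiv_eq_zero (h.contDiffAt hx) h0 (by simp [hp])
    (hasDerivAt_axis (k := k) t)
  have hlt := hlim.eventually_lt_const (u := 1 / (2 * b)) (by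
    have : 0 < 1 / (2 * b) := by positivity
    linarith)
  obtain ⟨ε₁, hε₁, hsmall⟩ := Metric.eventually_nhds_iff.1 (eventually_nhdsWithin_iff.1 hlt)
  obtain ⟨ε₂, hε₂, hball⟩ := Metric.isOpen_iff.1 isOpen_annulus p hx
  obtain ⟨τ, hτ, hτ1, hτ2, hτ3⟩ : ∃ τ > 0, τ < ε₁ ∧ τ < ε₂ ∧ τ < b := by
    refine ⟨min ε₁ (min ε₂ b) / 2, by positivity, ?_⟩
    have h1 : 0 < min ε₁ (min ε₂ b) := by positivity
    have h2 := half_lt_self h1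
    exact ⟨h2.trans_le (min_le_left _ _),
      h2.trans_le ((min_le_right _ _).trans (min_le_left _ _)),
      h2.trans_le ((min_le_right _ _).trans (min_le_right _ _))⟩
  have hq : ∀ s : ℝ, |s| = 1 →
      ‖(t - s * τ) • EuclideanSpace.single k (1 : ℝ) - p‖ = τ := by
    intro s hs
    rw [hp, ← sub_smul, norm_smul, PiLp.norm_single, norm_one, mul_one,
      Real.norm_eq_abs, sub_sub_cancel_left, abs_neg, abs_mul, hs, one_mul, abs_of_pos hτ]
  have hφ : ∀ s : ℝ, |s| = 1 →
      u ((t - s * τ) • EuclideanSpace.single k (1 : ℝ)) - u p < τ ^ 2 / (2 * b) := by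
    intro s hs
    have hsτ : |-(s * τ)| = τ := by rw [abs_neg, abs_mul, hs, one_mul, abs_of_pos hτ]
    have hne : -(s * τ) ≠ 0 := by
      rw [← abs_pos, hsτ]
      exact hτ
    have := @hsmall (-(s * τ)) (by rwa [dist_zero_right, Real.norm_eq_abs, hsτ]) hne
    rw [← sq_abs, hsτ, div_lt_iff₀ (by positivity), ← sub_eq_add_neg] at this
    rwa [div_eq_mul_one_div, mul_comm (τ ^ 2)]
  obtain ⟨η, hη, hη'⟩ : ∃ η > 0, ∀ s : ℝ, (s = 1 ∨ s = -1) →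
      u ((t - s * τ) • EuclideanSpace.single k (1 : ℝ)) - u p + η < τ ^ 2 / (2 * b) := by
    have h1 := hφ 1 (by simp)
    have h2 := hφ (-1) (by simp)
    set c₁ := u ((t - 1 * τ) • EuclideanSpace.single k (1 : ℝ))
    set c₂ := u ((t - -1 * τ) • EuclideanSpace.single k (1 : ℝ))
    have h3 : 0 < min (τ ^ 2 / (2 * b) - (c₁ - u p)) (τ ^ 2 / (2 * b) - (c₂ - u p)) :=
      lt_min (by linarith) (by linarith)
    have h4 := half_lt_self h3
    refine ⟨_, half_pos h3, ?_⟩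
    rintro s (rfl | rfl)
    · linarith [h4.trans_le (min_le_left _ _)]
    · linarith [h4.trans_le (min_le_right _ _)]
  set W : EuclideanSpace ℝ (Fin n) → ℝ := fun x => bowl p b x + (u p - η) with hW
  have hWc : Continuous W := continuous_bowl.add continuous_const
  set G := annulus k a ρ R ∩ ball p b with hG
  have hGΩ : G ⊆ annulus k a ρ R := inter_subset_left
  have hGB : G ⊆ ball p b := inter_subset_right
  have hGo : IsOpen G := isOpen_annulus.inter isOpen_ball
  have hGb : Bornology.IsBounded G := isBounded_annulus.subset hGΩ
  have huG : ContDiffOn ℝ 2 u G := h.contDiffOn.mono hGΩ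
  have hWG : ContDiffOn ℝ 2 W G := (contDiffOn_bowl.mono hGB).add contDiffOn_const
  have hucG : ContinuousOn u (closure G) := h.continuousOn.mono (closure_mono hGΩ)
  have hHu : ∀ x ∈ G, meanCurv u x = H := fun x hx => h.meanCurv_eq x hx.1
  have hHW : ∀ x ∈ G, meanCurv W x = H := fun x hx => by
    rw [hW, meanCurv_add_const, meanCurv_bowl hb0 hx.2, hnb]
  have hpG : p ∈ G := ⟨hx, mem_ball_self hb0⟩
  obtain ⟨E, hEpc, hpE, hEG, hEpos, hEmax, o, ho, hoG, hoW, homax⟩ :=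
    exists_component_of_meanCurv_eq hGo hGb huG hWG hucG hWc.continuousOn hH hHu hHW hpG
      (by simp only [hW, bowl_self hb0]; linarith)
  have hclG : ∀ x ∈ closure G, x ∈ closure (annulus k a ρ R) ∧ ‖x - p‖ ≤ b := fun x hx =>
    ⟨closure_mono hGΩ hx, by
      simpa [dist_eq_norm] using closure_ball_subset_closedBall (closure_mono hGB hx)⟩
  obtain ⟨hocl, hob⟩ := hclG o (closure_mono hEG ho)
  have hoΩ : o ∉ annulus k a ρ R := by
    intro hoΩ
    have hob : ‖o - p‖ = b := by
      refine le_antisymm hob (not_lt.1 fun hlt => hoG ⟨hoΩ, ?_⟩)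
      rwa [mem_ball, dist_eq_norm]
    refine not_eventually_sub_bowl_le hb0 hob
      ((h.contDiffAt hoΩ).differentiableAt (by norm_num)) ?_
    have hopen : IsOpen {x ∈ annulus k a ρ R | W x < u x} := by
      have heq : {x ∈ annulus k a ρ R | W x < u x} =
          annulus k a ρ R ∩ (W - u) ⁻¹' Iio 0 := by
        ext x
        simp
      rw [heq]
      exact (hWc.continuousOn.sub h.contDiffOn.continuousOn).isOpen_inter_preimage
        isOpen_annulus isOpen_Iio
    obtain ⟨ε, hε, hεb⟩ := Metric.isOpen_iff.1 hopen o ⟨hoΩ, hoW⟩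
    obtain ⟨w, hwE, hw⟩ := Metric.mem_closure_iff.1 ho ε hε
    have hAE : ball o ε ∩ ball p b ⊆ E := by
      refine hEmax _ ((convex_ball o ε).inter (convex_ball p b)).isPreconnected
        (fun x hx => ⟨(hεb hx.1).1, hx.2⟩) (fun x hx => (hεb hx.1).2)
        ⟨w, ⟨by rwa [mem_ball, dist_comm], hGB (hEG hwE)⟩, hwE⟩
    have hcont : Tendsto (fun s : ℝ => o - s • (o - p)) (𝓝[>] 0) (𝓝 o) := by
      have hc : Continuous fun s : ℝ => o - s • (o - p) := by fun_prop
      simpa using (hc.tendsto 0).mono_left nhdsWithin_le_nhds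
    filter_upwards [hcont.eventually (ball_mem_nhds o hε),
      Ioo_mem_nhdsGT (zero_lt_one' ℝ)] with s hs hs'
    have hsE : o - s • (o - p) ∈ E := by
      refine hAE ⟨hs, ?_⟩
      have h1 : o - s • (o - p) - p = (1 - s) • (o - p) := by module
      rw [mem_ball, dist_eq_norm, h1, norm_smul, hob, Real.norm_eq_abs,
        abs_of_pos (by linarith [hs'.2])]
      nlinarith [hs'.1]
    have := homax _ hsE
    simp only [hW] at this
    linarith
  have huo : u o = 0 := h.eq_zero_of_notMem hocl hoΩ
  have hτo : τ < ‖o - p‖ := by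
    by_contra hle
    refine hoΩ (hball ?_)
    rw [mem_ball, dist_eq_norm]
    linarith
  have hbowl : ∀ x w : EuclideanSpace ℝ (Fin n), W x < W w → ‖x - p‖ < ‖w - p‖ := by
    intro x w hxw
    by_contra hle
    have := bowl_le_bowl (h := b) (not_lt.1 hle)
    simp only [hW] at hxw
    linarith
  have sep : ∀ s : ℝ, (s = 1 ∨ s = -1) → (∀ x : EuclideanSpace ℝ (Fin n),
      ‖x - p‖ = ‖o - p‖ → s * x k ≤ s * o k → x ∉ annulus k a ρ R) → False := by
    intro s hs hout
    have hs1 : |s| = 1 := by rcases hs with rfl | rfl <;> simp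
    have hs2 : s ^ 2 = 1 := by rw [← sq_abs, hs1, one_pow]
    set q := (t - s * τ) • EuclideanSpace.single k (1 : ℝ) with hqdef
    have hqp : ‖q - p‖ = τ := hq s hs1
    have hqG : q ∈ G := by
      refine ⟨hball ?_, ?_⟩ <;> rw [mem_ball, dist_eq_norm, hqp] <;> assumption
    obtain ⟨N, hNpc, hqN, hNG, hNneg, -, y, hy, hyG, hyW, -⟩ :=
      exists_component_of_meanCurv_eq hGo hGb hWG huG hWc.continuousOn hucG hH hHW hHu hqG (by
        have h1 := sq_div_le_bowl hb0 (p := p) (x := q) (by linarith)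
        have h2 := hη' s hs
        rw [hqp] at h1
        simp only [hW]
        linarith)
    obtain ⟨hycl, hyb⟩ := hclG y (closure_mono hNG hy)
    have hyout : y ∉ annulus k a ρ R → ∀ x, x ∈ closure (annulus k a ρ R) → W x < u x →
        ‖x - p‖ < ‖y - p‖ := by
      intro hyΩ x hx hWx
      refine hbowl x y ?_
      rw [h.eq_zero_of_notMem hycl hyΩ] at hyW
      linarith [h.nonpos x hx]
    refine axial_separation hjk hs2 isClosed_closure (D := u - W) (C := closure (annulus k a ρ R))
      (h.continuousOn.sub hWc.continuousOn) ?_ (hEG.trans (hGΩ.trans subset_closure))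
      (hNG.trans (hGΩ.trans subset_closure)) hEpc hNpc (fun x hx => sub_pos.2 (hEpos x hx))
      (fun x hx => sub_neg.2 (hNneg x hx)) hτ hpE hqN ho hy (sub_pos.2 hoW) (sub_neg.2 hyW)
      hτo ?_ ?_
    · intro x hx w hk hn
      obtain ⟨h1, h2⟩ := h.eq_of_apply_eq_of_mem_closure hx hk hn
      refine ⟨h1, ?_⟩
      simp only [Pi.sub_apply, hW, bowl, h2]
      rw [hp, norm_sub_axis_eq hk hn]
    · intro x hxE
      by_cases hyΩ : y ∈ annulus k a ρ R
      · have h1 : ‖x - p‖ < b := by simpa [dist_eq_norm] using hGB (hEG hxE)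
        refine h1.trans_le (not_lt.1 fun hlt => hyG ⟨hyΩ, ?_⟩)
        rwa [mem_ball, dist_eq_norm]
      · exact hyout hyΩ x (subset_closure (hGΩ (hEG hxE))) (hEpos x hxE)
    · intro x hxo hxk
      have hxΩ := hout x hxo hxk
      refine ⟨fun hxN => hxΩ (hGΩ (hNG hxN)), ?_⟩
      rintro rfl
      exact absurd (hyout hxΩ o hocl hoW) (by rw [hxo]; exact lt_irrefl _)
  have hcmp : ∀ (x : EuclideanSpace ℝ (Fin n)) (c : ℝ), ‖x - p‖ = ‖o - p‖ →
      ‖x - c • EuclideanSpace.single k 1‖ ^ 2 - ‖o - c • EuclideanSpace.single k 1‖ ^ 2 =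
        2 * (c - t) * (o k - x k) := by
    intro x c hxo
    have h1 := norm_sub_axis_sq k x t
    have h2 := norm_sub_axis_sq k o t
    rw [← hp, hxo] at h1
    rw [← hp] at h2
    rw [norm_sub_axis_sq, norm_sub_axis_sq]
    linear_combination h2 - h1
  rw [mem_annulus_iff, not_and_or, not_lt, not_lt] at hoΩ
  rcases hoΩ with hoR | hoρ
  · refine sep 1 (Or.inl rfl) fun x hxo hxk hxΩ => ?_
    have h1 := hcmp x 0 hxo
    simp only [zero_smul, sub_zero] at h1
    have h2 := (mem_annulus_iff.1 hxΩ).1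
    have : 0 ≤ 2 * (0 - t) * (o k - x k) := mul_nonneg (by linarith) (by linarith)
    nlinarith [norm_nonneg x, norm_nonneg o]
  · refine sep (-1) (Or.inr rfl) fun x hxo hxk hxΩ => ?_
    have h1 := hcmp x a hxo
    have h2 := (mem_annulus_iff.1 hxΩ).2
    have : 0 ≤ 2 * (a - t) * (x k - o k) := mul_nonneg (by linarith [h.a_pos]) (by linarith)
    nlinarith [norm_nonneg (x - a • EuclideanSpace.single k 1),
      norm_nonneg (o - a • EuclideanSpace.single k 1)]

end IsAnnulusSolution

namespace IsAnnulusSolution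

variable {n : ℕ} {k j : Fin n} {a ρ R H : ℝ} {u : EuclideanSpace ℝ (Fin n) → ℝ}
  {x y : EuclideanSpace ℝ (Fin n)} {t : ℝ}

open Filter Topology in
theorem fderiv_axis_apply_eq_zero (h : IsAnnulusSolution k a ρ R H u)
    (hx : t • EuclideanSpace.single k 1 ∈ annulus k a ρ R) {i : Fin n} (hi : i ≠ k) :
    fderiv ℝ u (t • EuclideanSpace.single k 1) (EuclideanSpace.single i 1) = 0 := by
  set p : EuclideanSpace ℝ (Fin n) := t • EuclideanSpace.single k 1 with hp
  set e : EuclideanSpace ℝ (Fin n) := EuclideanSpace.single i 1 with he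
  have hcurve : ∀ c : ℝ, HasDerivAt (fun s : ℝ => u (p + s • (c • e))) (fderiv ℝ u p (c • e)) 0 := by
    intro c
    have h1 : HasDerivAt (fun s : ℝ => p + s • (c • e)) (c • e) 0 := by
      simpa using ((hasDerivAt_id (0 : ℝ)).smul_const (c • e)).const_add p
    have h2 : HasFDerivAt u (fderiv ℝ u p) (p + (0 : ℝ) • (c • e)) := by
      simpa using ((h.contDiffAt hx).differentiableAt (by norm_num)).hasFDerivAt
    exact h2.comp_hasDerivAt 0 h1
  have hev : (fun s : ℝ => u (p + s • ((1 : ℝ) • e))) =ᶠ[𝓝 0]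
      fun s : ℝ => u (p + s • ((-1 : ℝ) • e)) := by
    have hc : Tendsto (fun s : ℝ => p + s • ((-1 : ℝ) • e)) (𝓝 0) (𝓝 p) := by
      have hc : Continuous fun s : ℝ => p + s • ((-1 : ℝ) • e) := by fun_prop
      simpa using hc.tendsto 0
    filter_upwards [hc.eventually (isOpen_annulus.mem_nhds hx)] with s hs
    have hpe : inner ℝ p e = 0 := by
      simpa using inner_axis_eq_zero (t := t) 0 hi
    refine (h.eq_of_apply_eq hs ?_ ?_).2
    · simp [he, hi.symm]
    · rw [← pow_left_inj₀ (norm_nonneg _) (norm_nonneg _) two_ne_zero, norm_add_sq_real,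
        norm_add_sq_real]
      simp [inner_smul_right, hpe, norm_smul]
  have h1 := (hcurve 1).unique ((hcurve (-1)).congr_of_eventuallyEq hev)
  simp only [map_smul, smul_eq_mul] at h1
  linarith

theorem fderiv_axis_eq_zero (h : IsAnnulusSolution k a ρ R H u)
    (hx : t • EuclideanSpace.single k 1 ∈ annulus k a ρ R)
    (hk : fderiv ℝ u (t • EuclideanSpace.single k 1) (EuclideanSpace.single k 1) = 0) :
    fderiv ℝ u (t • EuclideanSpace.single k 1) = 0 := by
  refine ContinuousLinearMap.coe_injective
    ((EuclideanSpace.basisFun (Fin n) ℝ).toBasis.ext fun i => ?_)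
  rcases eq_or_ne i k with rfl | hi
  · simpa using hk
  · simpa using h.fderiv_axis_apply_eq_zero hx hi

open Filter Topology in
/-- Two strict local minima on the axis would enclose a maximum. -/
theorem not_lt_of_fderiv_eq_zero (h : IsAnnulusSolution k a ρ R H u) {t₁ t₂ : ℝ}
    (hmem : ∀ t ∈ Icc t₁ t₂, t • EuclideanSpace.single k 1 ∈ annulus k a ρ R)
    (hpos : ∀ t ∈ Icc t₁ t₂, fderiv ℝ u (t • EuclideanSpace.single k 1) = 0 →
      0 < fderiv ℝ (fderiv ℝ u) (t • EuclideanSpace.single k 1)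
        (EuclideanSpace.single k 1) (EuclideanSpace.single k 1))
    (h₁ : fderiv ℝ u (t₁ • EuclideanSpace.single k 1) = 0)
    (h₂ : fderiv ℝ u (t₂ • EuclideanSpace.single k 1) = 0) : ¬ t₁ < t₂ := by
  intro hlt
  set φ : ℝ → ℝ := fun t => u (t • EuclideanSpace.single k 1) with hφ
  have hφd : ∀ t ∈ Icc t₁ t₂, HasDerivAt φ
      (fderiv ℝ u (t • EuclideanSpace.single k 1) (EuclideanSpace.single k 1)) t := by
    intro t ht
    have h3 : HasDerivAt (fun s : ℝ => s • EuclideanSpace.single k (1 : ℝ))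
        (EuclideanSpace.single k 1) t := by
      simpa using (hasDerivAt_id t).smul_const (EuclideanSpace.single k (1 : ℝ))
    exact ((h.contDiffAt (hmem t ht)).differentiableAt (by norm_num)).hasFDerivAt.comp_hasDerivAt
      t h3
  have hstrict : ∀ t ∈ Icc t₁ t₂, fderiv ℝ u (t • EuclideanSpace.single k 1) = 0 →
      ∀ᶠ s in 𝓝[≠] 0, φ t < φ (t + s) := by
    intro t ht h0
    have hlim := tendsto_sub_div_sq_of_fderiv_eq_zero (h.contDiffAt (hmem t ht)) h0 (by simp)
      (hasDerivAt_axis (k := k) t)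
    have hp := hpos t ht h0
    filter_upwards [hlim.eventually_const_lt (u := 0) (by linarith), self_mem_nhdsWithin]
      with s hs hs0
    have hs0 : s ≠ 0 := hs0
    rw [div_pos_iff_of_pos_right (by positivity)] at hs
    linarith
  obtain ⟨t, ht, hmax⟩ := isCompact_Icc.exists_isMaxOn (nonempty_Icc.2 hlt.le)
    (fun t ht => (hφd t ht).continuousAt.continuousWithinAt)
  have hd : 0 < t₂ - t₁ := sub_pos.2 hlt
  have ht₁ : t ≠ t₁ := by
    rintro rfl
    have hr : 𝓝[>] (0 : ℝ) ≤ 𝓝[≠] 0 := nhdsWithin_mono _ fun s hs => (ne_of_gt hs)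
    obtain ⟨s, hs, hs'⟩ := (((hstrict t ht h₁).filter_mono hr).and (Ioo_mem_nhdsGT hd)).exists
    exact absurd (isMaxOn_iff.1 hmax (t + s) ⟨by linarith [hs'.1], by linarith [hs'.2]⟩)
      (not_le.2 hs)
  have ht₂ : t ≠ t₂ := by
    rintro rfl
    have hl : 𝓝[<] (0 : ℝ) ≤ 𝓝[≠] 0 := nhdsWithin_mono _ fun s hs => (ne_of_lt hs)
    obtain ⟨s, hs, hs'⟩ := (((hstrict t ht h₂).filter_mono hl).and
      (Ioo_mem_nhdsLT (neg_lt_zero.2 hd))).exists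
    exact absurd (isMaxOn_iff.1 hmax (t + s) ⟨by linarith [hs'.1], by linarith [hs'.2]⟩)
      (not_le.2 hs)
  have hnhds : Icc t₁ t₂ ∈ 𝓝 t :=
    Icc_mem_nhds (lt_of_le_of_ne ht.1 ht₁.symm) (lt_of_le_of_ne ht.2 ht₂)
  have h0 := h.fderiv_axis_eq_zero (hmem t ht)
    ((hmax.isLocalMax hnhds).hasDerivAt_eq_zero (hφd t ht))
  have hc : Tendsto (fun s : ℝ => t + s) (𝓝 0) (𝓝 t) := by
    have hc : Continuous fun s : ℝ => t + s := by fun_prop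
    simpa using hc.tendsto 0
  obtain ⟨s, hs, hs'⟩ := ((hstrict t ht h0).and
    ((hc.eventually hnhds).filter_mono nhdsWithin_le_nhds)).exists
  exact absurd (isMaxOn_iff.1 hmax (t + s) hs') (not_le.2 hs)

theorem smul_single_mem_annulus_iff :
    t • EuclideanSpace.single k 1 ∈ annulus k a ρ R ↔ |t| < R ∧ ρ < |t - a| := by
  rw [mem_annulus_iff, ← sub_smul, norm_smul, norm_smul]
  simp

/-- The critical points lie on the axis, and there are at most three of them. -/
theorem finite_critical (h : IsAnnulusSolution k a ρ R H u) (hjk : j ≠ k) :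
    {x | x ∈ annulus k a ρ R ∧ fderiv ℝ u x = 0}.Finite := by
  set T : Set ℝ := {t | t • EuclideanSpace.single k 1 ∈ annulus k a ρ R ∧
    fderiv ℝ u (t • EuclideanSpace.single k 1) = 0} with hT
  have hsub : {x | x ∈ annulus k a ρ R ∧ fderiv ℝ u x = 0} ⊆
      (fun t : ℝ => t • EuclideanSpace.single k (1 : ℝ)) '' T := by
    rintro x ⟨hx, h0⟩
    have he := h.eq_smul_of_fderiv_eq_zero hx h0
    refine ⟨x k, ⟨?_, ?_⟩, he.symm⟩
    · rwa [← he]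
    · rwa [← he]
  refine (Finite.image _ ?_).subset hsub
  have hρ := h.ρ_pos
  have ha := h.a_pos
  have hneg : (T ∩ Iio 0).Subsingleton := by
    have key : ∀ t₁ ∈ T ∩ Iio 0, ∀ t₂ ∈ T ∩ Iio 0, ¬ t₁ < t₂ := by
      rintro t₁ ⟨h1, -⟩ t₂ ⟨h2, h2n⟩ hlt
      have h2n : t₂ < 0 := h2n
      have hmem : ∀ t ∈ Icc t₁ t₂, t • EuclideanSpace.single k 1 ∈ annulus k a ρ R := by
        intro t ht
        have m1 := smul_single_mem_annulus_iff.1 h1.1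
        have m2 := smul_single_mem_annulus_iff.1 h2.1
        rw [smul_single_mem_annulus_iff, abs_of_nonpos (by linarith [ht.2]),
          abs_of_nonpos (by linarith [ht.2])]
        rw [abs_of_nonpos (by linarith)] at m1
        rw [abs_of_nonpos (a := t₂ - a) (by linarith)] at m2
        exact ⟨by linarith [ht.1], by linarith [ht.2]⟩
      exact h.not_lt_of_fderiv_eq_zero hmem (fun t ht h0 =>
        h.sndFDeriv_axis_pos_of_neg hjk (hmem t ht) h0 (by linarith [ht.2])) h1.2 h2.2 hlt
    intro t₁ h1 t₂ h2
    exact le_antisymm (not_lt.1 (key t₂ h2 t₁ h1)) (not_lt.1 (key t₁ h1 t₂ h2))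
  have hgt : (T ∩ Ioi a).Subsingleton := by
    have key : ∀ t₁ ∈ T ∩ Ioi a, ∀ t₂ ∈ T ∩ Ioi a, ¬ t₁ < t₂ := by
      rintro t₁ ⟨h1, h1a⟩ t₂ ⟨h2, -⟩ hlt
      have h1a : a < t₁ := h1a
      have hmem : ∀ t ∈ Icc t₁ t₂, t • EuclideanSpace.single k 1 ∈ annulus k a ρ R := by
        intro t ht
        have m1 := smul_single_mem_annulus_iff.1 h1.1
        have m2 := smul_single_mem_annulus_iff.1 h2.1
        rw [smul_single_mem_annulus_iff, abs_of_nonneg (by linarith [ht.1]),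
          abs_of_nonneg (by linarith [ht.1])]
        rw [abs_of_nonneg (a := t₁ - a) (by linarith)] at m1
        rw [abs_of_nonneg (a := t₂) (by linarith)] at m2
        exact ⟨by linarith [ht.2], by linarith [ht.1]⟩
      exact h.not_lt_of_fderiv_eq_zero hmem (fun t ht h0 =>
        h.sndFDeriv_axis_pos_of_gt (hmem t ht) h0 (by linarith [ht.1])) h1.2 h2.2 hlt
    intro t₁ h1 t₂ h2
    exact le_antisymm (not_lt.1 (key t₂ h2 t₁ h1)) (not_lt.1 (key t₁ h1 t₂ h2))
  refine ((hneg.finite.union hgt.finite).union (finite_singleton 0)).subset ?_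
  intro t ht
  rcases lt_trichotomy t 0 with h1 | h1 | h1
  · exact Or.inl (Or.inl ⟨ht, h1⟩)
  · exact Or.inr h1
  rcases lt_trichotomy t a with h2 | h2 | h2
  · exact absurd ht.2 (h.fderiv_ne_zero_of_mem_Ioo ht.1 ⟨h1, h2⟩)
  · have := (smul_single_mem_annulus_iff.1 ht.1).2
    rw [h2, sub_self, abs_zero] at this
    linarith
  · exact Or.inl (Or.inr ⟨ht, h2⟩)

end IsAnnulusSolution

section Reduction

variable {n : ℕ} {k j : Fin n} {a ρ R H : ℝ} {u : EuclideanSpace ℝ (Fin n) → ℝ}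

theorem neg_mem_annulus_iff {x : EuclideanSpace ℝ (Fin n)} :
    -x ∈ annulus k (-a) ρ R ↔ x ∈ annulus k a ρ R := by
  have h1 : -x - -a • EuclideanSpace.single k (1 : ℝ) = -(x - a • EuclideanSpace.single k 1) := by
    module
  rw [mem_annulus_iff, mem_annulus_iff, h1, norm_neg, norm_neg]

theorem axis_and_finite_critical_of_pos (hjk : j ≠ k) (ha : 0 < a) (hρ : 0 < ρ) (haR : a + ρ < R)
    (hu : ContDiffOn ℝ 2 u (annulus k a ρ R)) (huc : ContinuousOn u (closure (annulus k a ρ R)))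
    (hH : ∀ x ∈ annulus k a ρ R, meanCurv u x = H)
    (hb : ∀ x ∈ frontier (annulus k a ρ R), u x = 0) (hne : ∃ x ∈ annulus k a ρ R, u x ≠ 0) :
    (∀ x ∈ annulus k a ρ R, fderiv ℝ u x = 0 → ∀ i ≠ k, x i = 0) ∧
      {x | x ∈ annulus k a ρ R ∧ fderiv ℝ u x = 0}.Finite := by
  have hHn : ∀ x ∈ annulus k a ρ R, meanCurv (-u) x = -H := fun x hx => by
    rw [meanCurv_neg, hH x hx]
  have hbn : ∀ x ∈ frontier (annulus k a ρ R), (-u) x = 0 := fun x hx => by simp [hb x hx]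
  rcases lt_trichotomy H 0 with hH0 | hH0 | hH0
  · have h : IsAnnulusSolution k a ρ R (-H) (-u) :=
      ⟨ha, hρ, haR, neg_pos.2 hH0, hu.neg, huc.neg, hHn, hbn⟩
    have hd : ∀ x, fderiv ℝ (-u) x = 0 ↔ fderiv ℝ u x = 0 := fun x => by
      rw [fderiv_neg, neg_eq_zero]
    refine ⟨fun x hx h0 i hi => h.apply_eq_zero_of_fderiv_eq_zero hx ((hd x).2 h0) hi, ?_⟩
    simpa only [hd] using h.finite_critical hjk
  · obtain ⟨x, hx, hux⟩ := hne
    have h1 := nonpos_of_meanCurv_eq_zero k.pos isOpen_annulus sdiff_subset hu huc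
      (fun x hx => by rw [hH x hx, hH0]) hb x hx
    have h2 := nonpos_of_meanCurv_eq_zero k.pos isOpen_annulus sdiff_subset hu.neg huc.neg
      (fun x hx => (hHn x hx).trans (by rw [hH0, neg_zero])) hbn x hx
    exact absurd (le_antisymm h1 (by simpa using h2)) hux
  · have h : IsAnnulusSolution k a ρ R H u := ⟨ha, hρ, haR, hH0, hu, huc, hH, hb⟩
    exact ⟨fun x hx h0 i hi => h.apply_eq_zero_of_fderiv_eq_zero hx h0 hi,
      h.finite_critical hjk⟩

/-- All critical points of a nontrivial solution lie on the axis, and they are finitely many. -/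
theorem axis_and_finite_critical (hjk : j ≠ k) (ha : a ≠ 0) (hρ : 0 < ρ) (haR : |a| + ρ < R)
    (hu : ContDiffOn ℝ 2 u (annulus k a ρ R)) (huc : ContinuousOn u (closure (annulus k a ρ R)))
    (hH : ∀ x ∈ annulus k a ρ R, meanCurv u x = H)
    (hb : ∀ x ∈ frontier (annulus k a ρ R), u x = 0) (hne : ∃ x ∈ annulus k a ρ R, u x ≠ 0) :
    (∀ x ∈ annulus k a ρ R, fderiv ℝ u x = 0 → ∀ i ≠ k, x i = 0) ∧
      {x | x ∈ annulus k a ρ R ∧ fderiv ℝ u x = 0}.Finite := by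
  rcases ha.lt_or_gt with ha | ha
  · have hmem : ∀ x ∈ annulus k (-a) ρ R, -x ∈ annulus k a ρ R := fun x hx => by
      have := (neg_mem_annulus_iff (k := k) (a := -a) (ρ := ρ) (R := R)).2 hx
      rwa [neg_neg] at this
    have hcl : ∀ x ∈ closure (annulus k (-a) ρ R), -x ∈ closure (annulus k a ρ R) :=
      fun x hx => map_mem_closure continuous_neg hx hmem
    have hd : ∀ x, fderiv ℝ (fun y => u (-y)) (-x) = 0 ↔ fderiv ℝ u x = 0 := fun x => by
      have h1 := fderiv_comp_smul (𝕜 := ℝ) (f := u) (x := -x) (-1)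
      simp only [neg_smul, one_smul, neg_neg] at h1
      rw [h1, neg_eq_zero]
    obtain ⟨h1, h2⟩ := axis_and_finite_critical_of_pos (u := fun y => u (-y)) (H := H) hjk
      (neg_pos.2 ha) hρ (by rwa [abs_of_neg ha] at haR)
      (hu.comp contDiff_neg.contDiffOn hmem) (huc.comp continuous_neg.continuousOn hcl)
      (fun x hx => by
        have h3 := meanCurv_comp_similarity one_pos (LinearIsometryEquiv.neg ℝ) (b := 0) (x := x)
          (u := u) (by
            simpa using hu.contDiffAt (isOpen_annulus.mem_nhds (hmem x hx)))
        simpa [hH _ (hmem x hx)] using h3)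
      (fun x hx => hb _ ⟨hcl x hx.1, fun hx' => hx.2 (by
        rw [isOpen_annulus.interior_eq] at hx' ⊢
        simpa using neg_mem_annulus_iff.2 hx')⟩)
      (by
        obtain ⟨x, hx, hux⟩ := hne
        exact ⟨-x, neg_mem_annulus_iff.2 hx, by simpa using hux⟩)
    refine ⟨fun x hx h0 i hi => ?_, (h2.image Neg.neg).subset ?_⟩
    · simpa using h1 (-x) (neg_mem_annulus_iff.2 hx) ((hd x).2 h0) i hi
    · rintro x ⟨hx, h0⟩
      exact ⟨-x, ⟨neg_mem_annulus_iff.2 hx, (hd x).2 h0⟩, neg_neg x⟩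
  · exact axis_and_finite_critical_of_pos hjk ha hρ (by rwa [abs_of_pos ha] at haR) hu huc hH hb
      hne

theorem abs_add_lt_of_closure_ball_subset (hρ : 0 < ρ)
    (hsub : closure (ball (a • EuclideanSpace.single k (1 : ℝ)) ρ) ⊆ ball 0 R) :
    |a| + ρ < R := by
  have key : ∀ s : ℝ, |s| = 1 → |a + s * ρ| < R := by
    intro s hs
    have h1 : (a + s * ρ) • EuclideanSpace.single k (1 : ℝ) ∈
        closure (ball (a • EuclideanSpace.single k (1 : ℝ)) ρ) := by
      rw [closure_ball _ hρ.ne', mem_closedBall, dist_eq_norm, ← sub_smul, norm_smul]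
      simp [hs, abs_of_pos hρ]
    simpa [norm_smul] using hsub h1
  rcases abs_cases a with ⟨h1, -⟩ | ⟨h1, -⟩
  · have := (abs_lt.1 (key 1 (by simp))).2
    linarith
  · have := (abs_lt.1 (key (-1) (by simp))).1
    linarith

end Reduction

/-- In an eccentric spherical annulus of `ℝⁿ` (`n ≥ 3`), the critical set
`K` of a nontrivial axially symmetric solution of the constant mean curvature equation with
zero Dirichlet data is invariant under all rotations about the axis, its trace on a
meridian half-plane is finite, and consequently `K` is the union of finitely many isolated
points on the axis and finitely many rotation orbits of points off the axis. -/
theorem critical_set_eccentric_annulus_structure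
    (n : ℕ) (hn : 3 ≤ n) (k : Fin n) (hk : (k : ℕ) = n - 1)
    (j : Fin n) (hj : (j : ℕ) = 0)
    (a : ℝ) (ha : a ≠ 0)
    (z : EuclideanSpace ℝ (Fin n)) (hz : z = a • EuclideanSpace.single k 1)
    (ρ R : ℝ) (hρ : 0 < ρ) (hρR : ρ < R)
    (hsub : closure (Metric.ball z ρ) ⊆ Metric.ball (0 : EuclideanSpace ℝ (Fin n)) R)
    (Ω : Set (EuclideanSpace ℝ (Fin n)))
    (hΩ : Ω = Metric.ball (0 : EuclideanSpace ℝ (Fin n)) R \ closure (Metric.ball z ρ))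
    (H : ℝ) (u : EuclideanSpace ℝ (Fin n) → ℝ)
    (huC2 : ContDiffOn ℝ 2 u Ω) (huC : ContinuousOn u (closure Ω))
    (hu : ∀ x ∈ Ω, meanCurv u x = H)
    (hbdry : ∀ x ∈ frontier Ω, u x = 0)
    (hune : ∃ x ∈ Ω, u x ≠ 0)
    (husym : ∀ g : EuclideanSpace ℝ (Fin n) ≃ₗᵢ[ℝ] EuclideanSpace ℝ (Fin n),
      IsAxisRotation k g → ∀ x ∈ closure Ω, u (g x) = u x)
    (K : Set (EuclideanSpace ℝ (Fin n))) (hK : K = {x | x ∈ Ω ∧ gradient u x = 0}) :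
    (∀ g : EuclideanSpace ℝ (Fin n) ≃ₗᵢ[ℝ] EuclideanSpace ℝ (Fin n),
      IsAxisRotation k g → g '' K = K) ∧
    (K ∩ {x : EuclideanSpace ℝ (Fin n) | 0 ≤ x j ∧
      ∀ i : Fin n, i ≠ j → i ≠ k → x i = 0}).Finite ∧
    ∃ P Q : Finset (EuclideanSpace ℝ (Fin n)),
      (∀ p ∈ P, ∀ i : Fin n, i ≠ k → p i = 0) ∧
      (∀ q ∈ Q, ∃ i : Fin n, i ≠ k ∧ q i ≠ 0) ∧
      K = ↑P ∪ ⋃ q ∈ Q,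
        {x | ∃ g : EuclideanSpace ℝ (Fin n) ≃ₗᵢ[ℝ] EuclideanSpace ℝ (Fin n),
          IsAxisRotation k g ∧ g q = x} := by
  have hjk : j ≠ k := fun h => by
    have := congrArg Fin.val h
    omega
  subst hz
  have hΩ' : Ω = annulus k a ρ R := by rw [hΩ, closure_ball _ hρ.ne', annulus]
  subst hΩ'
  have hKf : K ⊆ {x | x ∈ annulus k a ρ R ∧ fderiv ℝ u x = 0} := fun x hx => by
    rw [hK] at hx
    exact ⟨hx.1, fderiv_eq_zero_of_gradient_eq_zero hx.2⟩
  obtain ⟨haxis, hfin⟩ := axis_and_finite_critical hjk ha hρ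
    (abs_add_lt_of_closure_ball_subset hρ hsub) huC2 huC hu hbdry hune
  have hKfin : K.Finite := hfin.subset hKf
  have hKaxis : ∀ x ∈ K, ∀ i, i ≠ k → x i = 0 := fun x hx i hi =>
    haxis x (hKf hx).1 (hKf hx).2 i hi
  refine ⟨fun g hg => ?_, hKfin.subset inter_subset_left, hKfin.toFinset, ∅, ?_, by simp, by simp⟩
  · have hfix : ∀ x ∈ K, g x = x := by
      intro x hx
      have hxe : x = x k • EuclideanSpace.single k 1 := by
        ext i
        rcases eq_or_ne i k with rfl | hi
        · simp
        · simp [hKaxis x hx i hi, hi]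
      rw [hxe, map_smul, hg.1]
    rw [image_congr hfix, image_id']
  · intro p hp
    exact hKaxis p (hKfin.mem_toFinset.1 hp)
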